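/- arXiv:2109.00487 — 2 statements merged into one kernel-verified Lean document; each statement's English description precedes it below -/
import Mathlib

section
/- Under Assumptions 1 and 2, if the instruments are strictly costly, then every optimal mechanism (every mechanism attaining the supremum of the principal's payoff over all mechanisms) satisfies y(θ) = y₀ for γ-almost every θ. -/
open MeasureTheory Set ProbabilityTheory

noncomputable section

/-- `κ` is a regular conditional distribution of the second coordinate given the
first coordinate, under the joint law `γ`. -/
def IsRCD {A B : Type*} [MeasurableSpace A] [MeasurableSpace B]
    (γ : Measure (A × B)) (κ : Kernel A B) : Prop :=
  IsMarkovKernel κ ∧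
    ∀ s : Set (A × B), MeasurableSet s →
      γ s = ∫⁻ a, κ a {b | (a, b) ∈ s} ∂γ.fst

/-- The topological support of a measure on `ℝ`. -/
def MSupport (μ : Measure ℝ) : Set ℝ :=
  {a | ∀ U : Set ℝ, IsOpen U → a ∈ U → 0 < μ U}

variable {N : ℕ} {Y : Type} [MeasurableSpace Y]

/-- A measurable IC and IR mechanism in the two-component screening model (with
integrable transfer, so that the principal's payoff is well defined). -/
def Mechanism (ΘA : Set ℝ) (ΘB : Set (Fin N → ℝ)) (X : Set ℝ)
    (uA : ℝ → ℝ → ℝ) (uB : Y → (Fin N → ℝ) → ℝ)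
    (γ : Measure (ℝ × (Fin N → ℝ)))
    (x : ℝ × (Fin N → ℝ) → ℝ) (y : ℝ × (Fin N → ℝ) → Y)
    (t : ℝ × (Fin N → ℝ) → ℝ) : Prop :=
  Measurable x ∧ Measurable y ∧ Measurable t ∧ Integrable t γ ∧
    (∀ θ ∈ ΘA ×ˢ ΘB, x θ ∈ X) ∧
    (∀ θ ∈ ΘA ×ˢ ΘB, ∀ θ' ∈ ΘA ×ˢ ΘB,
      uA (x θ) θ.1 + uB (y θ) θ.2 - t θ ≥ uA (x θ') θ.1 + uB (y θ') θ.2 - t θ') ∧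
    (∀ θ ∈ ΘA ×ˢ ΘB, uA (x θ) θ.1 + uB (y θ) θ.2 - t θ ≥ 0)

/-- The principal's expected payoff. -/
def Payoff (vA : ℝ → ℝ → ℝ) (vB : Y → (Fin N → ℝ) → ℝ)
    (γ : Measure (ℝ × (Fin N → ℝ)))
    (x : ℝ × (Fin N → ℝ) → ℝ) (y : ℝ × (Fin N → ℝ) → Y)
    (t : ℝ × (Fin N → ℝ) → ℝ) : ℝ :=
  ∫ θ, (vA (x θ) θ.1 + vB (y θ) θ.2 + t θ) ∂γ

/-- A mechanism involves no costly screening: `y ≡ y₀` and `(x, t)` depend only on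
the productive type `θ^A`. -/
def NoCostlyScreening (y₀ : Y)
    (x : ℝ × (Fin N → ℝ) → ℝ) (y : ℝ × (Fin N → ℝ) → Y)
    (t : ℝ × (Fin N → ℝ) → ℝ) : Prop :=
  (∀ θ, y θ = y₀) ∧
    ∀ θ θ' : ℝ × (Fin N → ℝ), θ.1 = θ'.1 → x θ = x θ' ∧ t θ = t θ'

lemma exists_finset_left_net {S : Set ℝ} (hS : IsCompact S) {δ : ℝ} (hδ : 0 < δ) :
    ∃ F : Finset ℝ, (∀ f ∈ F, f ∈ S) ∧ ∀ x ∈ S, ∃ f ∈ F, f ≤ x ∧ x < f + δ := by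
  classical
  obtain ⟨R, hR⟩ := hS.isBounded.exists_norm_le
  refine ⟨((Finset.Icc ⌊-R / δ⌋ ⌊R / δ⌋).image
    (fun k : ℤ => sInf (S ∩ Ici (k * δ)))).filter (· ∈ S), by simp, fun x hx => ?_⟩
  have hxR := abs_le.1 (hR x hx)
  have hfl : (⌊x / δ⌋ : ℝ) * δ ≤ x := (le_div_iff₀ hδ).1 (Int.floor_le _)
  have hfu : x < ((⌊x / δ⌋ : ℝ) + 1) * δ := (div_lt_iff₀ hδ).1 (Int.lt_floor_add_one _)
  have hmem := (hS.inter_right isClosed_Ici).sInf_mem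
    (⟨x, hx, hfl⟩ : (S ∩ Ici ((⌊x / δ⌋ : ℝ) * δ)).Nonempty)
  refine ⟨sInf (S ∩ Ici ((⌊x / δ⌋ : ℝ) * δ)), ?_, ?_, ?_⟩
  · simp only [Finset.mem_filter, Finset.mem_image, Finset.mem_Icc]
    refine ⟨⟨⌊x / δ⌋, ⟨Int.floor_le_floor ?_, Int.floor_le_floor ?_⟩, rfl⟩, hmem.1⟩
    · gcongr; exact hxR.1
    · gcongr; exact hxR.2
  · exact csInf_le ⟨_, fun z hz => hz.2⟩ ⟨hx, hfl⟩
  · have := hmem.2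
    simp only [mem_Ici] at this
    linarith

/-- A nonempty compact set of reals is partitioned by finitely many left-closed cells of small
diameter, each containing its left end point. -/
lemma exists_strictMono_left_net {S : Set ℝ} (hS : IsCompact S) (hne : S.Nonempty) {δ : ℝ}
    (hδ : 0 < δ) :
    ∃ (m : ℕ) (τ : ℕ → ℝ), (∀ j ≤ m, τ j ∈ S) ∧ (∀ i j, i < j → j ≤ m → τ i < τ j) ∧
      ∀ x ∈ S, ∃ j ≤ m, τ j ≤ x ∧ x < τ j + δ := by
  obtain ⟨F, hFS, hF⟩ := exists_finset_left_net hS hδ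
  obtain ⟨x₀, hx₀⟩ := hne
  obtain ⟨f₀, hf₀, -⟩ := hF x₀ hx₀
  have hcard : F.card = (F.card - 1) + 1 := by
    have := Finset.card_pos.2 ⟨f₀, hf₀⟩
    omega
  set m := F.card - 1 with hm
  refine ⟨m, fun j => F.orderEmbOfFin hcard (Fin.ofNat (m + 1) j), fun j _ =>
    hFS _ (Finset.orderEmbOfFin_mem _ _ _), fun i j hij hj => ?_, fun x hx => ?_⟩
  · simp only [OrderEmbedding.lt_iff_lt, Fin.lt_def, Fin.val_ofNat]
    rw [Nat.mod_eq_of_lt (by omega), Nat.mod_eq_of_lt (by omega)]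
    exact hij
  · obtain ⟨f, hf, h⟩ := hF x hx
    have : f ∈ Set.range (F.orderEmbOfFin hcard) := by
      rw [Finset.range_orderEmbOfFin]; exact hf
    obtain ⟨k, rfl⟩ := this
    refine ⟨k, by omega, ?_⟩
    simpa using h

lemma integrable_of_abs_le {α : Type*} [MeasurableSpace α] {μ : Measure α} [IsFiniteMeasure μ]
    {f : α → ℝ} (hf : Measurable f) {C : ℝ} (hC : ∀ᵐ x ∂μ, |f x| ≤ C) : Integrable f μ :=
  Integrable.of_bound hf.aestronglyMeasurable C (by simpa using hC)

/-- A monotone measurable minorant of the running supremum of `H` over the second coordinate,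
which is as large as `H` on average, up to `ε`. -/
lemma exists_monotone_le_sup (μ : Measure (ℝ × (Fin N → ℝ))) [IsFiniteMeasure μ]
    {K E : Set (ℝ × (Fin N → ℝ))} (hK : IsCompact K) (hE : MeasurableSet E) (hEK : E ⊆ K)
    (hμE : ∀ᵐ θ ∂μ, θ ∈ E) {H : ℝ × (Fin N → ℝ) → ℝ} (hH : Measurable H) {C : ℝ} (hC0 : 0 ≤ C)
    (hC : ∀ θ ∈ E, |H θ| ≤ C) {ε : ℝ} (hε : 0 < ε) :
    ∃ M : (Fin N → ℝ) → ℝ, Measurable M ∧ Monotone M ∧ (∀ b, |M b| ≤ C) ∧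
      (∀ b v, v < M b → v < -C ∨ ∃ θ ∈ E, θ.2 ≤ b ∧ v < H θ) ∧
      ∫ θ, H θ ∂μ ≤ ∫ θ, M θ.2 ∂μ + ε := by
  classical
  set f : ℝ × (Fin N → ℝ) → NNReal := E.indicator (fun θ => Real.toNNReal (H θ + C)) with hf
  have hfm : Measurable f := ((hH.add_const C).real_toNNReal).indicator hE
  have hfE : ∀ θ ∈ E, (f θ : ℝ) = H θ + C := fun θ hθ => by
    rw [hf, Set.indicator_of_mem hθ, Real.coe_toNNReal]
    linarith [(abs_le.1 (hC θ hθ)).1]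
  have hfE' : ∀ θ ∉ E, (f θ : ℝ) = 0 := fun θ hθ => by
    rw [hf, Set.indicator_of_notMem hθ]; rfl
  have hfint : Integrable (fun θ => (f θ : ℝ)) μ :=
    integrable_of_abs_le (C := 2 * C) hfm.coe_nnreal_real (by
      filter_upwards [hμE] with θ hθ
      rw [hfE θ hθ, abs_le]
      constructor <;> linarith [(abs_le.1 (hC θ hθ)).1, (abs_le.1 (hC θ hθ)).2])
  obtain ⟨g, hgf, hgu, hgint, hg⟩ := exists_upperSemicontinuous_le_integral_le f hfint hε
  have hg2C : ∀ θ, (g θ : ℝ) ≤ 2 * C := fun θ => by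
    have h1 : (g θ : ℝ) ≤ f θ := by exact_mod_cast hgf θ
    by_cases hθ : θ ∈ E
    · rw [hfE θ hθ] at h1
      linarith [(abs_le.1 (hC θ hθ)).2]
    · rw [hfE' θ hθ] at h1
      linarith
  let G : (Fin N → ℝ) → Set (ℝ × (Fin N → ℝ)) := fun b => K ∩ {θ | θ.2 ≤ b}
  have hGc : ∀ b, IsCompact (G b) := fun b =>
    hK.inter_right (isClosed_le continuous_snd continuous_const)
  let m : (Fin N → ℝ) → ℝ := fun b => sSup ((fun θ => (g θ : ℝ)) '' G b)
  have hbdd : ∀ b, BddAbove ((fun θ => (g θ : ℝ)) '' G b) := fun b =>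
    ⟨2 * C, by rintro _ ⟨θ, -, rfl⟩; exact hg2C θ⟩
  have hm0 : ∀ b, 0 ≤ m b := fun b => Real.sSup_nonneg (by rintro _ ⟨θ, -, rfl⟩; positivity)
  have hm2C : ∀ b, m b ≤ 2 * C := fun b =>
    Real.sSup_le (by rintro _ ⟨θ, -, rfl⟩; exact hg2C θ) (by linarith)
  have hmatt : ∀ b c, 0 < c → (c ≤ m b ↔ ∃ θ ∈ G b, c ≤ g θ) := by
    intro b c hc
    constructor
    · intro h
      rcases (G b).eq_empty_or_nonempty with he | hne
      · simp only [m, he, Set.image_empty, Real.sSup_empty] at h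
        linarith
      · obtain ⟨θ, hθ, hmax⟩ := UpperSemicontinuousOn.exists_isMaxOn hne (hGc b)
          (hgu.upperSemicontinuousOn _)
        refine ⟨θ, hθ, h.trans (csSup_le (hne.image _) ?_)⟩
        rintro _ ⟨θ', hθ', rfl⟩
        exact_mod_cast hmax hθ'
    · rintro ⟨θ, hθ, h⟩
      exact h.trans (le_csSup (hbdd b) ⟨θ, hθ, rfl⟩)
  have hmm : Measurable m := by
    refine measurable_of_Ici fun c => ?_
    rcases le_or_gt c 0 with hc | hc
    · convert MeasurableSet.univ
      ext b
      simpa using hc.trans (hm0 b)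
    · have hKc : IsCompact (K ∩ {θ | c.toNNReal ≤ g θ}) :=
        hK.inter_right (upperSemicontinuous_iff_isClosed_preimage.1 hgu c.toNNReal)
      have hcl : IsClosed (Prod.snd '' (((K ∩ {θ | c.toNNReal ≤ g θ}) ×ˢ univ) ∩
          {p : (ℝ × (Fin N → ℝ)) × (Fin N → ℝ) | p.1.2 ≤ p.2})) := by
        have := isCompact_iff_compactSpace.1 hKc
        have h1 : IsClosed {p : (K ∩ {θ | c.toNNReal ≤ g θ} : Set _) × (Fin N → ℝ) |
            p.1.1.2 ≤ p.2} := isClosed_le (by fun_prop) (by fun_prop)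
        have h2 := isClosedMap_snd_of_compactSpace _ h1
        convert h2 using 1
        ext b
        simp only [Set.mem_image, Prod.exists, Subtype.exists]
        constructor
        · rintro ⟨a, b', b'', ⟨⟨h, -⟩, h'⟩, rfl⟩
          exact ⟨a, b', h, b'', h', rfl⟩
        · rintro ⟨a, b', h, b'', h', rfl⟩
          exact ⟨a, b', b'', ⟨⟨h, trivial⟩, h'⟩, rfl⟩
      convert hcl.measurableSet using 1
      ext b
      simp only [Set.mem_preimage, mem_Ici, hmatt b c hc]
      constructor
      · rintro ⟨θ, ⟨hθK, hθb⟩, hθ⟩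
        exact ⟨(θ, b), ⟨⟨⟨hθK, Real.toNNReal_le_iff_le_coe.2 hθ⟩, trivial⟩, hθb⟩, rfl⟩
      · rintro ⟨⟨θ, b'⟩, ⟨⟨⟨hθK, hθ⟩, -⟩, hθb⟩, rfl⟩
        exact ⟨θ, ⟨hθK, hθb⟩, Real.toNNReal_le_iff_le_coe.1 hθ⟩
  have hmi : Integrable (fun θ : ℝ × (Fin N → ℝ) => m θ.2) μ :=
    integrable_of_abs_le (C := 2 * C) (hmm.comp measurable_snd)
      (.of_forall fun θ => by rw [abs_of_nonneg (hm0 _)]; exact hm2C _)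
  refine ⟨fun b => m b - C, hmm.sub_const C, fun b b' hbb => ?_, fun b => ?_, fun b v hv => ?_, ?_⟩
  · rcases (hm0 b).eq_or_lt with h | h
    · simp only [← h]
      linarith [hm0 b']
    · obtain ⟨θ, hθ, h'⟩ := (hmatt b _ h).1 le_rfl
      have := (hmatt b' _ h).2 ⟨θ, ⟨hθ.1, le_trans hθ.2 hbb⟩, h'⟩
      simp only
      linarith
  · rw [abs_le]
    constructor <;> linarith [hm0 b, hm2C b]
  · rcases lt_or_ge v (-C) with h | h
    · exact Or.inl h
    · obtain ⟨θ, hθ, h'⟩ := (hmatt b (m b) (by linarith)).1 le_rfl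
      have hgf' : (g θ : ℝ) ≤ f θ := by exact_mod_cast hgf θ
      have hθE : θ ∈ E := by
        by_contra hθE
        rw [hfE' θ hθE] at hgf'
        linarith
      rw [hfE θ hθE] at hgf'
      exact Or.inr ⟨θ, hθE, hθ.2, by linarith⟩
  · have h1 : ∫ θ, H θ ∂μ = ∫ θ, ((f θ : ℝ) - C) ∂μ := by
      refine integral_congr_ae ?_
      filter_upwards [hμE] with θ hθ
      rw [hfE θ hθ]; ring
    have h2 : ∫ θ, (g θ : ℝ) ∂μ ≤ ∫ θ, m θ.2 ∂μ := by
      refine integral_mono_ae hgint hmi ?_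
      filter_upwards [hμE] with θ hθ
      exact le_csSup (hbdd _) ⟨θ, ⟨hEK hθ, le_refl θ.2⟩, rfl⟩
    rw [h1, integral_sub hfint (integrable_const C), integral_sub hmi (integrable_const C)]
    linarith

lemma ae_mem_MSupport (μ : Measure ℝ) : ∀ᵐ a ∂μ, a ∈ MSupport μ := by
  rw [ae_iff]
  refine measure_null_of_locally_null _ fun a ha => ?_
  simp only [MSupport, mem_ofPred_eq, not_forall, not_lt, nonpos_iff_eq_zero] at ha
  obtain ⟨U, hU, haU, h⟩ := ha
  exact ⟨U, mem_nhdsWithin_of_mem_nhds (hU.mem_nhds haU), h⟩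

lemma IsRCD.compProd_eq {A B : Type*} [MeasurableSpace A] [MeasurableSpace B]
    {γ : Measure (A × B)} [IsFiniteMeasure γ] {κ : Kernel A B} (h : IsRCD γ κ) :
    γ.fst ⊗ₘ κ = γ := by
  have := h.1
  ext s hs
  rw [Measure.compProd_apply hs, h.2 s hs]
  rfl

lemma IsRCD.setIntegral_snd {A B : Type*} [MeasurableSpace A] [MeasurableSpace B]
    {γ : Measure (A × B)} [IsFiniteMeasure γ] {κ : Kernel A B} (h : IsRCD γ κ) {G : B → ℝ}
    (hG : Measurable G) {C : ℝ} (hC : ∀ b, |G b| ≤ C) {s : Set A} (hs : MeasurableSet s) :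
    ∫ θ in Prod.fst ⁻¹' s, G θ.2 ∂γ = ∫ a in s, ∫ b, G b ∂κ a ∂γ.fst := by
  have := h.1
  have hint : Integrable (fun θ : A × B => G θ.2) (γ.fst ⊗ₘ κ) :=
    integrable_of_abs_le (hG.comp measurable_snd) (.of_forall fun θ => hC _)
  have := Measure.setIntegral_compProd (μ := γ.fst) (κ := κ) hs MeasurableSet.univ
    hint.integrableOn
  rw [h.compProd_eq, prod_univ] at this
  simpa using this

/-- If every chain of types, one in each cell and with nondecreasing second coordinates, satisfies
the bound `V` for the weighted sum of the values of `h`, then the integral of `h` satisfies it too,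
provided that the second coordinate is stochastically nondecreasing in the first one. -/
lemma sum_setIntegral_le_of_forall_path {γ : Measure (ℝ × (Fin N → ℝ))}
    [IsProbabilityMeasure γ] {κ : Kernel ℝ (Fin N → ℝ)} (hκ : IsRCD γ κ)
    (hmono : ∀ a ∈ MSupport γ.fst, ∀ a' ∈ MSupport γ.fst, a < a' →
      ∀ f : (Fin N → ℝ) → ℝ, Measurable f → Monotone f → (∃ M, ∀ b, |f b| ≤ M) →
        ∫ b, f b ∂(κ a) ≤ ∫ b, f b ∂(κ a'))
    {ΘA : Set ℝ} {ΘB : Set (Fin N → ℝ)} (hΘA : IsCompact ΘA) (hΘB : IsCompact ΘB)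
    (hΘBne : ΘB.Nonempty) (hγ : ∀ᵐ θ ∂γ, θ ∈ ΘA ×ˢ ΘB) {c : ℝ → ℕ} (hc : Monotone c) {n : ℕ}
    (hcell : ∀ j < n, ∃ a ∈ ΘA, c a = j) {h : ℝ × (Fin N → ℝ) → ℝ} (hh : Measurable h)
    {C : ℝ} (hC : ∀ θ ∈ ΘA ×ˢ ΘB, |h θ| ≤ C) {V : ℝ}
    (hV : ∀ θ : ℕ → ℝ × (Fin N → ℝ), (∀ j < n, θ j ∈ ΘA ×ˢ ΘB ∧ c (θ j).1 = j) →
      (∀ i j, i ≤ j → j < n → (θ i).2 ≤ (θ j).2) →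
      ∑ j ∈ Finset.range n, γ.real {θ | c θ.1 = j} * h (θ j) ≤ V) :
    ∑ j ∈ Finset.range n, ∫ θ in {θ | c θ.1 = j}, h θ ∂γ ≤ V := by
  have hκM := hκ.1
  have hC0 : 0 ≤ C := by
    obtain ⟨θ, hθ⟩ := hγ.exists
    exact (abs_nonneg _).trans (hC θ hθ)
  have hcellm : ∀ j, MeasurableSet (c ⁻¹' {j}) := fun j => hc.measurable (measurableSet_singleton j)
  have hcellm' : ∀ j, MeasurableSet {θ : ℝ × (Fin N → ℝ) | c θ.1 = j} := fun j =>
    measurable_fst (hcellm j)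
  have hΘm : MeasurableSet (ΘA ×ˢ ΘB) := hΘA.measurableSet.prod hΘB.measurableSet
  have hw : ∀ j, γ.fst.real (c ⁻¹' {j}) = γ.real {θ | c θ.1 = j} := fun j => by
    rw [measureReal_def, Measure.fst_apply (hcellm j)]
    rfl
  refine le_of_forall_pos_le_add fun η hη => ?_
  set ε := η / (n + 1) with hε
  have hε0 : 0 < ε := by positivity
  have hεn : ε * n ≤ η := by
    rw [hε, div_mul_eq_mul_div, div_le_iff₀ (by positivity)]
    nlinarith
  suffices H : ∀ i ≤ n, ∃ M : (Fin N → ℝ) → ℝ, Measurable M ∧ Monotone M ∧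
      (∃ D, 0 ≤ D ∧ ∀ b, |M b| ≤ D) ∧
      (∀ b ∈ ΘB, ∀ v < M b, ∃ θ : ℕ → ℝ × (Fin N → ℝ),
        (∀ j < i, θ j ∈ ΘA ×ˢ ΘB ∧ c (θ j).1 = j) ∧
        (∀ j k, j ≤ k → k < i → (θ j).2 ≤ (θ k).2) ∧ (∀ j < i, (θ j).2 ≤ b) ∧
        v < ∑ j ∈ Finset.range i, γ.real {θ | c θ.1 = j} * h (θ j)) ∧
      (∀ a ∈ MSupport γ.fst, i ≤ c a →
        ∑ j ∈ Finset.range i, ∫ θ in {θ | c θ.1 = j}, h θ ∂γ ≤ ∫ b, M b ∂κ a + ε * i) ∧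
      (∀ v, (∀ b ∈ ΘB, M b ≤ v) →
        ∑ j ∈ Finset.range i, ∫ θ in {θ | c θ.1 = j}, h θ ∂γ ≤ v + ε * i) by
    obtain ⟨M, -, -, -, h1, -, h3⟩ := H n le_rfl
    refine (h3 V fun b hb => ?_).trans (by linarith)
    by_contra! hlt
    obtain ⟨θ, hθ, hθm, -, hv⟩ := h1 b hb V hlt
    linarith [hV θ hθ hθm]
  intro i
  induction i with
  | zero =>
    refine fun _ => ⟨fun _ => 0, measurable_const, monotone_const, ⟨0, le_rfl, by simp⟩,
      fun b hb v hv => ⟨fun _ => 0, by simp, by simp, by simp, by simpa using hv⟩, by simp,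
      fun v hv => ?_⟩
    obtain ⟨b, hb⟩ := hΘBne
    simpa using hv b hb
  | succ i ih =>
    intro hi
    obtain ⟨M, hMm, hMmono, ⟨D, hD0, hD⟩, h1, h2, h3⟩ := ih (by omega)
    set w := γ.real {θ | c θ.1 = i} with hwdef
    have hw0 : 0 ≤ w := measureReal_nonneg
    have hw1 : w ≤ 1 := measureReal_le_one
    obtain ⟨a₀, ha₀, ha₀i⟩ := hcell i (by omega)
    have hext : ∀ b v (θ' : ℝ × (Fin N → ℝ)), θ' ∈ ΘA ×ˢ ΘB → c θ'.1 = i → θ'.2 ≤ b →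
        v < M θ'.2 + w * h θ' → ∃ θ : ℕ → ℝ × (Fin N → ℝ),
        (∀ j < i + 1, θ j ∈ ΘA ×ˢ ΘB ∧ c (θ j).1 = j) ∧
        (∀ j k, j ≤ k → k < i + 1 → (θ j).2 ≤ (θ k).2) ∧ (∀ j < i + 1, (θ j).2 ≤ b) ∧
        v < ∑ j ∈ Finset.range (i + 1), γ.real {θ | c θ.1 = j} * h (θ j) := by
      intro b v θ' hθ' hci hb hv
      obtain ⟨θ, hθ, hθm, hθb, hθv⟩ := h1 θ'.2 hθ'.2 (v - w * h θ') (by linarith)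
      have hne : ∀ j < i, Function.update θ i θ' j = θ j := fun j hj =>
        Function.update_of_ne (by omega) _ _
      have heq : Function.update θ i θ' i = θ' := Function.update_self _ _ _
      have hle : ∀ j < i + 1, (Function.update θ i θ' j).2 ≤ θ'.2 := fun j hj => by
        rcases Nat.lt_succ_iff_lt_or_eq.1 hj with hj | rfl
        · rw [hne j hj]; exact hθb j hj
        · rw [heq]
      refine ⟨Function.update θ i θ', fun j hj => ?_, fun j k hjk hk => ?_,
        fun j hj => (hle j hj).trans hb, ?_⟩
      · rcases Nat.lt_succ_iff_lt_or_eq.1 hj with hj | rfl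
        · rw [hne j hj]; exact hθ j hj
        · rw [heq]; exact ⟨hθ', hci⟩
      · rcases Nat.lt_succ_iff_lt_or_eq.1 hk with hk | rfl
        · rw [hne j (by omega), hne k hk]; exact hθm j k hjk hk
        · rw [heq]; exact hle j (by omega)
      · rw [Finset.sum_range_succ, heq, Finset.sum_congr rfl fun j hj => by
          rw [hne j (Finset.mem_range.1 hj)]]
        linarith
    rcases hw0.eq_or_lt with hw00 | hwpos
    · have hz : ∫ θ in {θ | c θ.1 = i}, h θ ∂γ = 0 := by
        have h0 : γ {θ : ℝ × (Fin N → ℝ) | c θ.1 = i} = 0 :=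
          (measureReal_eq_zero_iff).1 hw00.symm
        rw [Measure.restrict_eq_zero.2 h0, integral_zero_measure]
      refine ⟨M, hMm, hMmono, ⟨D, hD0, hD⟩, fun b hb v hv => ?_, fun a ha hia => ?_,
        fun v hv => ?_⟩
      · exact hext b v (a₀, b) ⟨ha₀, hb⟩ ha₀i le_rfl (by rw [← hw00]; simpa using hv)
      · rw [Finset.sum_range_succ, hz]
        push_cast
        linarith [h2 a ha (by omega)]
      · rw [Finset.sum_range_succ, hz]
        push_cast
        linarith [h3 v hv]
    · have hEm : MeasurableSet ((ΘA ×ˢ ΘB) ∩ {θ | c θ.1 = i}) := hΘm.inter (hcellm' i)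
      have hHm : Measurable fun θ : ℝ × (Fin N → ℝ) => M θ.2 + w * h θ :=
        (hMm.comp measurable_snd).add (hh.const_mul w)
      have hHb : ∀ θ ∈ (ΘA ×ˢ ΘB) ∩ {θ | c θ.1 = i}, |M θ.2 + w * h θ| ≤ D + C := by
        rintro θ ⟨hθ, -⟩
        refine (abs_add_le _ _).trans (add_le_add (hD _) ?_)
        rw [abs_mul, abs_of_nonneg hw0]
        nlinarith [hC θ hθ, abs_nonneg (h θ)]
      have hae : ∀ᵐ θ ∂γ.restrict {θ | c θ.1 = i}, θ ∈ (ΘA ×ˢ ΘB) ∩ {θ | c θ.1 = i} := by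
        filter_upwards [ae_restrict_of_ae hγ, ae_restrict_mem (hcellm' i)] with θ h1 h2
        exact ⟨h1, h2⟩
      obtain ⟨M', hM'm, hM'mono, hM'b, hM's, hM'int⟩ := exists_monotone_le_sup
        (γ.restrict {θ | c θ.1 = i}) (hΘA.prod hΘB) hEm inter_subset_left hae hHm
        (add_nonneg hD0 hC0) hHb (mul_pos hwpos hε0)
      have hsplit : ∫ θ in {θ | c θ.1 = i}, (M θ.2 + w * h θ) ∂γ =
          ∫ θ in {θ | c θ.1 = i}, M θ.2 ∂γ + w * ∫ θ in {θ | c θ.1 = i}, h θ ∂γ := by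
        rw [integral_add, integral_const_mul]
        · exact integrable_of_abs_le (hMm.comp measurable_snd) (.of_forall fun θ => hD _)
        · refine (integrable_of_abs_le hh (C := C) ?_).const_mul w
          filter_upwards [hae] with θ hθ using hC θ hθ.1
      have hintM' : Integrable (fun θ : ℝ × (Fin N → ℝ) => M' θ.2)
          (γ.restrict {θ | c θ.1 = i}) :=
        integrable_of_abs_le (hM'm.comp measurable_snd) (.of_forall fun θ => hM'b _)
      have hκint : ∀ {G : (Fin N → ℝ) → ℝ} {B : ℝ}, Measurable G → (∀ b, |G b| ≤ B) →
          Integrable (fun a => ∫ b, G b ∂κ a) (γ.fst.restrict (c ⁻¹' {i})) := by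
        intro G B hG hB
        refine integrable_of_abs_le (C := B)
          (hG.stronglyMeasurable.integral_kernel (κ := κ)).measurable (.of_forall fun a => ?_)
        have := norm_integral_le_of_norm_le_const (μ := κ a) (f := G) (C := B)
          (.of_forall fun b => by simpa using hB b)
        simpa using this
      have hMge : w * (∑ j ∈ Finset.range i, ∫ θ in {θ | c θ.1 = j}, h θ ∂γ - ε * i) ≤
          ∫ θ in {θ | c θ.1 = i}, M θ.2 ∂γ := by
        have e1 := hκ.setIntegral_snd hMm hD (hcellm i)
        change ∫ θ in {θ | c θ.1 = i}, M θ.2 ∂γ = _ at e1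
        rw [e1]
        have := integral_mono_ae (μ := γ.fst.restrict (c ⁻¹' {i}))
          (integrable_const (∑ j ∈ Finset.range i, ∫ θ in {θ | c θ.1 = j}, h θ ∂γ - ε * i))
          (hκint hMm hD) (by
            filter_upwards [ae_restrict_of_ae (ae_mem_MSupport γ.fst),
              ae_restrict_mem (hcellm i)] with a ha hai
            have := h2 a ha (le_of_eq hai.symm)
            linarith)
        rw [integral_const, smul_eq_mul, measureReal_restrict_apply_univ, hw i] at this
        exact this
      have hbound : ∀ v, ∫ θ in {θ | c θ.1 = i}, M' θ.2 ∂γ ≤ w * v →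
          ∑ j ∈ Finset.range (i + 1), ∫ θ in {θ | c θ.1 = j}, h θ ∂γ ≤
            v + ε * (i + 1 : ℕ) := by
        intro v hv
        rw [Finset.sum_range_succ]
        refine le_of_mul_le_mul_left ?_ hwpos
        push_cast
        rw [hsplit] at hM'int
        nlinarith
      refine ⟨M', hM'm, hM'mono, ⟨D + C, add_nonneg hD0 hC0, hM'b⟩, fun b hb v hv => ?_,
        fun a ha hia => hbound _ ?_, fun v hv => hbound v ?_⟩
      · rcases hM's b v hv with hv' | ⟨θ, hθ, hθb, hv'⟩
        · refine hext b v (a₀, b) ⟨ha₀, hb⟩ ha₀i le_rfl ?_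
          have := (abs_le.1 (hHb (a₀, b) ⟨⟨ha₀, hb⟩, ha₀i⟩)).1
          exact hv'.trans_le this
        · exact hext b v θ hθ.1 hθ.2 hθb hv'
      · have e1 := hκ.setIntegral_snd hM'm hM'b (hcellm i)
        change ∫ θ in {θ | c θ.1 = i}, M' θ.2 ∂γ = _ at e1
        rw [e1]
        have := integral_mono_ae (μ := γ.fst.restrict (c ⁻¹' {i})) (hκint hM'm hM'b)
          (integrable_const (∫ b, M' b ∂κ a)) (by
            filter_upwards [ae_restrict_of_ae (ae_mem_MSupport γ.fst),
              ae_restrict_mem (hcellm i)] with a' ha' hai'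
            refine hmono a' ha' a ha ?_ M' hM'm hM'mono ⟨_, hM'b⟩
            by_contra! hle
            have := hc hle
            simp only [Set.mem_preimage, Set.mem_singleton_iff] at hai'
            omega)
        rw [integral_const, smul_eq_mul, measureReal_restrict_apply_univ, hw i] at this
        exact this
      · have := integral_mono_ae hintM' (integrable_const v) (by
          filter_upwards [hae] with θ hθ using hv _ hθ.1.2)
        rw [integral_const, smul_eq_mul, measureReal_restrict_apply_univ] at this
        exact this

/-- The prices of the menu items `z 0 ≤ z 1 ≤ ⋯` that make the type `τ 0` indifferent between
`z 0` and its outside option, and the type `τ (i + 1)` indifferent between `z i` and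
`z (i + 1)`. -/
def menuPrice (u : ℝ → ℝ → ℝ) (τ z : ℕ → ℝ) : ℕ → ℝ
  | 0 => u (z 0) (τ 0)
  | i + 1 => menuPrice u τ z i + (u (z (i + 1)) (τ (i + 1)) - u (z i) (τ (i + 1)))

lemma sub_menuPrice_le {u : ℝ → ℝ → ℝ} {X A : Set ℝ}
    (hID : ∀ x ∈ X, ∀ x' ∈ X, x ≤ x' → ∀ a ∈ A, ∀ a' ∈ A, a ≤ a' →
      u x' a - u x a ≤ u x' a' - u x a')
    {m : ℕ} {τ z : ℕ → ℝ} (hz : Monotone z) (hzX : ∀ j ≤ m, z j ∈ X) (hτ : ∀ j ≤ m, τ j ∈ A)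
    {a : ℝ} (ha : a ∈ A) {i : ℕ} (him : i ≤ m) (hlo : ∀ k ≤ i, τ k ≤ a)
    (hhi : ∀ k, i < k → k ≤ m → a ≤ τ k) {j : ℕ} (hj : j ≤ m) :
    u (z j) a - menuPrice u τ z j ≤ u (z i) a - menuPrice u τ z i := by
  rcases le_total j i with hji | hij
  · have key : ∀ k, j ≤ k → k ≤ i →
        u (z j) a - menuPrice u τ z j ≤ u (z k) a - menuPrice u τ z k := by
      intro k hk
      induction k, hk using Nat.le_induction with
      | base => exact fun _ => le_rfl
      | succ k hk ih =>
        intro hki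
        have h1 := ih (by omega)
        have h2 := hID _ (hzX k (by omega)) _ (hzX (k + 1) (by omega)) (hz k.le_succ)
          _ (hτ (k + 1) (by omega)) a ha (hlo _ hki)
        rw [menuPrice]
        linarith
    exact key i hji le_rfl
  · have key : ∀ k, i ≤ k → k ≤ m →
        u (z k) a - menuPrice u τ z k ≤ u (z i) a - menuPrice u τ z i := by
      intro k hk
      induction k, hk using Nat.le_induction with
      | base => exact fun _ => le_rfl
      | succ k hk ih =>
        intro hki
        have h1 := ih (by omega)
        have h2 := hID _ (hzX k (by omega)) _ (hzX (k + 1) (by omega)) (hz k.le_succ)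
          a ha _ (hτ (k + 1) (by omega)) (hhi _ (by omega) hki)
        rw [menuPrice]
        linarith
    exact key j hij hj

/-- If `v` satisfies the downward incentive constraints for the allocation `x` at the types `a`,
then the rents of the running maximum of `x` do not exceed `v`, up to an error for each jump. -/
lemma partialSups_sub_menuPrice_le {u : ℝ → ℝ → ℝ} {A : Set ℝ} {F : Finset ℝ}
    (hu : ∀ f ∈ F, ∀ a ∈ A, ∀ a' ∈ A, a ≤ a' → u f a ≤ u f a')
    {m : ℕ} {τ a x v : ℕ → ℝ} (hx : ∀ j ≤ m, x j ∈ F) (hτ : ∀ j ≤ m, τ j ∈ A)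
    (ha : ∀ j ≤ m, a j ∈ A) (hτa : ∀ j ≤ m, τ j ≤ a j) {ω : ℝ} (hω0 : 0 ≤ ω)
    (hω : ∀ f ∈ F, ∀ j ≤ m, u f (a j) - u f (τ j) ≤ ω) (hv0 : 0 ≤ v 0)
    (hv : ∀ j k, j ≤ k → k ≤ m → v j + (u (x j) (a k) - u (x j) (a j)) ≤ v k)
    {i : ℕ} (hi : i ≤ m) {a' w : ℝ}
    (hw : ∀ j ≤ i, v j + (u (x j) a' - u (x j) (a j)) ≤ w) :
    u (partialSups x i) a' - menuPrice u τ (partialSups x) i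
      - ω * ((F.filter (· < partialSups x i)).card + 1) ≤ w := by
  have hF : ∀ j ≤ m, partialSups x j ∈ F := fun j hj => by
    obtain ⟨k, hk, h⟩ := exists_partialSups_eq x j
    rw [h]
    exact hx k (by omega)
  induction i generalizing a' w with
  | zero =>
    have h1 := hw 0 le_rfl
    have h2 := hω _ (hx 0 (by omega)) 0 (by omega)
    have h3 : (0 : ℝ) ≤ ω * ((F.filter (· < partialSups x 0)).card) := by positivity
    rw [menuPrice]
    simp only [partialSups_zero] at h3 ⊢
    linarith
  | succ i ih =>
    rcases le_or_gt (x (i + 1)) (partialSups x i) with h | h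
    · have heq : partialSups x (i + 1) = partialSups x i := by
        rw [partialSups_add_one, sup_eq_left.2 h]
      rw [menuPrice, heq, sub_self, add_zero]
      exact ih (by omega) fun j hj => hw j (by omega)
    · have heq : partialSups x (i + 1) = x (i + 1) := by
        rw [partialSups_add_one, sup_eq_right.2 h.le]
      have h1 := ih (by omega) (a' := a (i + 1)) (w := v (i + 1))
        fun j hj => hv j (i + 1) (by omega) hi
      have h2 := hw (i + 1) le_rfl
      have h3 := hω _ (hx _ hi) (i + 1) hi
      have h4 := hu _ (hF i (by omega)) _ (hτ _ hi) _ (ha _ hi) (hτa _ hi)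
      have h5 : (F.filter (· < partialSups x i)).card + 1 ≤ (F.filter (· < x (i + 1))).card := by
        refine Finset.card_lt_card ((Finset.ssubset_iff_of_subset fun f hf => ?_).2
          ⟨partialSups x i, ?_, ?_⟩)
        · simp only [Finset.mem_filter] at hf ⊢
          exact ⟨hf.1, hf.2.trans h⟩
        · simp only [Finset.mem_filter]
          exact ⟨hF i (by omega), h⟩
        · simp
      have h6 : ω * ((F.filter (· < partialSups x i)).card + 1) ≤
          ω * (F.filter (· < x (i + 1))).card := by
        have : ((F.filter (· < partialSups x i)).card : ℝ) + 1 ≤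
          (F.filter (· < x (i + 1))).card := by exact_mod_cast h5
        gcongr
      rw [menuPrice, heq]
      linarith

/-- The running maximum of an allocation has a larger surplus at each type, if lowering the
allocation at any type strictly lowers the surplus. -/
lemma le_surplus_partialSups {s : ℝ → ℝ → ℝ} {X A : Set ℝ} {F : Finset ℝ}
    (hFX : ∀ f ∈ F, f ∈ X)
    (hs : ∀ x ∈ X, ∀ x' ∈ X, x < x' → ∀ a ∈ A, ∀ a' ∈ A, a < a' →
      0 < s x' a - s x a → 0 < s x' a' - s x a')
    {m : ℕ} {a x : ℕ → ℝ} (ha : ∀ j ≤ m, a j ∈ A) (hlt : ∀ j k, j < k → k ≤ m → a j < a k)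
    (hx : ∀ j ≤ m, x j ∈ F) (hmax : ∀ j ≤ m, ∀ f ∈ F, f < x j → s f (a j) < s (x j) (a j))
    {i : ℕ} (hi : i ≤ m) : s (x i) (a i) ≤ s (partialSups x i) (a i) := by
  obtain ⟨k, hk, h⟩ := exists_partialSups_eq x i
  have hle : x i ≤ x k := h ▸ le_partialSups x i
  rw [h]
  rcases hle.eq_or_lt with h' | h'
  · rw [h']
  · have hki : k < i := lt_of_le_of_ne hk (by rintro rfl; exact h'.false)
    have := hs _ (hFX _ (hx i hi)) _ (hFX _ (hx k (by omega))) h' _ (ha k (by omega)) _ (ha i hi)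
      (hlt k i hki hi) (sub_pos.2 (hmax k (by omega) _ (hx i hi) h'))
    linarith

lemma exists_least_argmax_le {F : Finset ℝ} (g : ℝ → ℝ) {f₀ : ℝ} (hf₀ : f₀ ∈ F) :
    ∃ f ∈ F, f ≤ f₀ ∧ g f₀ ≤ g f ∧ ∀ f' ∈ F, f' < f → g f' < g f := by
  classical
  obtain ⟨p, hp, hpmax⟩ := (F.filter (· ≤ f₀)).exists_max_image g ⟨f₀, by simp [hf₀]⟩
  obtain ⟨f, hf, hfmin⟩ := (F.filter (fun q => q ≤ f₀ ∧ g p ≤ g q)).exists_min_image id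
    ⟨p, by simp_all⟩
  simp only [Finset.mem_filter] at hp hf hfmin hpmax
  refine ⟨f, hf.1, hf.2.1, (hpmax f₀ ⟨hf₀, le_rfl⟩).trans hf.2.2, fun f' hf' hlt => ?_⟩
  by_contra! hle
  exact absurd (hfmin f' ⟨hf', hlt.le.trans hf.2.1, hf.2.2.trans hle⟩) (not_le.2 hlt)

lemma exists_menu {u s : ℝ → ℝ → ℝ} {X A : Set ℝ} {F : Finset ℝ} (hFX : ∀ f ∈ F, f ∈ X)
    (hu : ∀ x ∈ X, ∀ a ∈ A, ∀ a' ∈ A, a ≤ a' → u x a ≤ u x a')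
    (hID : ∀ x ∈ X, ∀ x' ∈ X, x ≤ x' → ∀ a ∈ A, ∀ a' ∈ A, a ≤ a' →
      u x' a - u x a ≤ u x' a' - u x a')
    (hs : ∀ x ∈ X, ∀ x' ∈ X, x < x' → ∀ a ∈ A, ∀ a' ∈ A, a < a' →
      0 < s x' a - s x a → 0 < s x' a' - s x a')
    {m : ℕ} {τ a x v : ℕ → ℝ} (hx : ∀ j ≤ m, x j ∈ X) (hτ : ∀ j ≤ m, τ j ∈ A)
    (ha : ∀ j ≤ m, a j ∈ A) (hτa : ∀ j ≤ m, τ j ≤ a j) (hlt : ∀ j k, j < k → k ≤ m → a j < a k)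
    {η ω : ℝ} (hω0 : 0 ≤ ω) (hωη : ω * (F.card + 1) ≤ η)
    (hF : ∀ x ∈ X, ∃ f ∈ F, f ≤ x ∧ ∀ a ∈ A, s x a ≤ s f a + η)
    (hω : ∀ x ∈ X, ∀ j ≤ m, u x (a j) - u x (τ j) ≤ ω) (hv0 : 0 ≤ v 0)
    (hv : ∀ j k, j ≤ k → k ≤ m → v j + (u (x j) (a k) - u (x j) (a j)) ≤ v k) :
    ∃ z : ℕ → ℝ, Monotone z ∧ (∀ j ≤ m, z j ∈ X) ∧ ∀ i ≤ m,
      u (z i) (a i) - menuPrice u τ z i ≤ v i + η ∧ s (x i) (a i) ≤ s (z i) (a i) + η := by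
  have hex : ∀ j, ∃ f, j ≤ m → f ∈ F ∧ f ≤ x j ∧ s (x j) (a j) ≤ s f (a j) + η ∧
      ∀ f' ∈ F, f' < f → s f' (a j) < s f (a j) := by
    intro j
    by_cases hj : j ≤ m
    · obtain ⟨f₀, hf₀, hle, hη⟩ := hF _ (hx j hj)
      obtain ⟨f, hf, hff₀, hs', hmin⟩ := exists_least_argmax_le (fun f => s f (a j)) hf₀
      exact ⟨f, fun _ => ⟨hf, hff₀.trans hle, by linarith [hη _ (ha j hj)], hmin⟩⟩
    · exact ⟨0, fun h => absurd h hj⟩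
  choose g hg using hex
  have hgF : ∀ j ≤ m, g j ∈ F := fun j hj => (hg j hj).1
  refine ⟨partialSups g, (partialSups g).monotone, fun j hj => ?_, fun i hi => ⟨?_, ?_⟩⟩
  · obtain ⟨k, hk, h⟩ := exists_partialSups_eq g j
    rw [h]
    exact hFX _ (hgF k (by omega))
  · have hgv : ∀ j k, j ≤ k → k ≤ m → v j + (u (g j) (a k) - u (g j) (a j)) ≤ v k := by
      intro j k hjk hk
      have h1 := hv j k hjk hk
      have hajk : a j ≤ a k := by
        rcases hjk.eq_or_lt with rfl | h
        · exact le_rfl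
        · exact (hlt _ _ h hk).le
      have h2 := hID _ (hFX _ (hgF j (by omega))) _ (hx j (by omega)) (hg j (by omega)).2.1
        _ (ha j (by omega)) _ (ha k hk) hajk
      linarith
    have h1 := partialSups_sub_menuPrice_le (fun f hf => hu f (hFX f hf)) hgF hτ ha hτa hω0
      (fun f hf => hω f (hFX f hf)) hv0 hgv hi (fun j hj => hgv j i hj hi)
    have h2 : ω * ((F.filter (· < partialSups g i)).card + 1) ≤ ω * (F.card + 1) := by
      have : ((F.filter (· < partialSups g i)).card : ℝ) ≤ F.card := by
        exact_mod_cast Finset.card_filter_le _ _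
      gcongr
    linarith
  · have h1 := le_surplus_partialSups hFX hs ha hlt hgF (fun j hj => (hg j hj).2.2.2) hi
    linarith [(hg i hi).2.2.1]

lemma exists_pos_forall_abs_sub_lt {f : ℝ → ℝ → ℝ} {X A : Set ℝ} (hX : IsCompact X)
    (hA : IsCompact A) (hf : ContinuousOn (fun p : ℝ × ℝ => f p.1 p.2) (X ×ˢ A))
    {ε : ℝ} (hε : 0 < ε) :
    ∃ δ > 0, ∀ x ∈ X, ∀ x' ∈ X, ∀ a ∈ A, ∀ a' ∈ A, |x - x'| < δ → |a - a'| < δ →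
      |f x a - f x' a'| < ε := by
  obtain ⟨δ, hδ, h⟩ := Metric.uniformContinuousOn_iff.1
    ((hX.prod hA).uniformContinuousOn_of_continuous hf) ε hε
  refine ⟨δ, hδ, fun x hx x' hx' a ha a' ha' h1 h2 => ?_⟩
  have := h (x, a) ⟨hx, ha⟩ (x', a') ⟨hx', ha'⟩
    (by rw [Prod.dist_eq]; exact max_lt (by rwa [Real.dist_eq]) (by rwa [Real.dist_eq]))
  rwa [Real.dist_eq] at this

lemma exists_abs_le_of_continuousOn {f : ℝ → ℝ → ℝ} {X A : Set ℝ} (hX : IsCompact X)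
    (hA : IsCompact A) (hf : ContinuousOn (fun p : ℝ × ℝ => f p.1 p.2) (X ×ˢ A)) :
    ∃ C, ∀ x ∈ X, ∀ a ∈ A, |f x a| ≤ C := by
  obtain ⟨C, hC⟩ := (hX.prod hA).exists_bound_of_continuousOn hf
  exact ⟨C, fun x hx a ha => hC (x, a) ⟨hx, ha⟩⟩

/-- A partition of a compact set of reals into finitely many order intervals of length less than
`δ`, each of which contains its infimum. -/
lemma exists_cells {S : Set ℝ} (hS : IsCompact S) (hne : S.Nonempty) {δ : ℝ} (hδ : 0 < δ) :
    ∃ (m : ℕ) (τ : ℕ → ℝ) (c : ℝ → ℕ), Monotone c ∧ (∀ a, c a ≤ m) ∧ (∀ j ≤ m, τ j ∈ S) ∧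
      (∀ j ≤ m, c (τ j) = j) ∧ (∀ a ∈ S, ∀ k ≤ c a, τ k ≤ a) ∧
      (∀ a, ∀ k, c a < k → k ≤ m → a ≤ τ k) ∧ ∀ a ∈ S, a < τ (c a) + δ := by
  classical
  obtain ⟨m, τ, hτS, hτ, hnet⟩ := exists_strictMono_left_net hS hne hδ
  have hτ' : ∀ i j, i ≤ j → j ≤ m → τ i ≤ τ j := fun i j hij hj => by
    rcases hij.eq_or_lt with rfl | h
    · exact le_rfl
    · exact (hτ _ _ h hj).le
  have hlow : ∀ a j, j ≤ m → τ j ≤ a → τ (Nat.findGreatest (fun j => τ j ≤ a) m) ≤ a :=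
    fun a j hj h => Nat.findGreatest_spec (P := fun j => τ j ≤ a) hj h
  refine ⟨m, τ, fun a => Nat.findGreatest (fun j => τ j ≤ a) m, fun a b hab => ?_,
    fun a => Nat.findGreatest_le m, hτS, fun j hj => ?_, fun a ha k hk => ?_,
    fun a k hk hkm => ?_, fun a ha => ?_⟩
  · exact Nat.findGreatest_mono (fun j (hj : τ j ≤ a) => hj.trans hab) le_rfl
  · refine le_antisymm ?_ (Nat.le_findGreatest hj le_rfl)
    by_contra! h
    exact absurd (hlow (τ j) j hj le_rfl) (not_le.2 (hτ _ _ h (Nat.findGreatest_le m)))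
  · obtain ⟨j, hj, hja, -⟩ := hnet a ha
    exact (hτ' _ _ hk (Nat.findGreatest_le m)).trans (hlow a j hj hja)
  · exact (not_le.1 (Nat.findGreatest_is_greatest (P := fun j => τ j ≤ a) hk hkm)).le
  · obtain ⟨j, hj, hja, hlt⟩ := hnet a ha
    have := hτ' _ _ (Nat.le_findGreatest (P := fun j => τ j ≤ a) hj hja) (Nat.findGreatest_le m)
    linarith

lemma sum_setIntegral_fiber {α : Type*} [MeasurableSpace α] {μ : Measure α} {c : α → ℕ}
    (hc : Measurable c) {n : ℕ} (hcn : ∀ a, c a < n) {f : α → ℝ} (hf : Integrable f μ) :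
    ∑ j ∈ Finset.range n, ∫ a in {a | c a = j}, f a ∂μ = ∫ a, f a ∂μ := by
  rw [← integral_biUnion_finset]
  · have : ⋃ j ∈ Finset.range n, {a | c a = j} = univ := by
      ext a
      simpa using hcn a
    rw [this, setIntegral_univ]
  · exact fun j _ => hc (measurableSet_singleton j)
  · intro i _ j _ hij
    exact disjoint_left.2 fun a (hi : c a = i) (hj : c a = j) => hij (hi.symm.trans hj)
  · exact fun j _ => hf.integrableOn

lemma sum_measureReal_fiber_mul_le {α : Type*} [MeasurableSpace α] {μ : Measure α}
    [IsProbabilityMeasure μ] {c : α → ℕ} (hc : Measurable c) {n : ℕ} (hcn : ∀ a, c a < n)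
    {φ : ℕ → ℝ} {f : α → ℝ} (hf : Integrable f μ) {ε : ℝ} (h : ∀ᵐ a ∂μ, φ (c a) ≤ f a + ε) :
    ∑ j ∈ Finset.range n, μ.real {a | c a = j} * φ j ≤ ∫ a, f a ∂μ + ε := by
  have hφ : Integrable (fun a => φ (c a)) μ := by
    refine integrable_of_abs_le ((measurable_of_countable φ).comp hc)
      (C := ∑ j ∈ Finset.range n, |φ j|) (ae_of_all _ fun a => ?_)
    exact Finset.single_le_sum (f := fun j => |φ j|) (fun j _ => abs_nonneg _)
      (Finset.mem_range.2 (hcn a))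
  calc ∑ j ∈ Finset.range n, μ.real {a | c a = j} * φ j
      = ∑ j ∈ Finset.range n, ∫ a in {a | c a = j}, φ (c a) ∂μ := by
        refine Finset.sum_congr rfl fun j _ => ?_
        have hj : MeasurableSet {a | c a = j} := hc (measurableSet_singleton j)
        rw [setIntegral_congr_fun (g := fun _ => φ j) hj
          (fun a (ha : c a = j) => by simp only [ha]), setIntegral_const, smul_eq_mul]
    _ = ∫ a, φ (c a) ∂μ := sum_setIntegral_fiber hc hcn hφ
    _ ≤ ∫ a, (f a + ε) ∂μ := integral_mono_ae hφ (hf.add (integrable_const ε)) h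
    _ = ∫ a, f a ∂μ + ε := by
        rw [integral_add hf (integrable_const ε)]
        simp

lemma mechanism_menu {y₀ : Y} {ΘA : Set ℝ}
    {ΘB : Set (Fin N → ℝ)} {X : Set ℝ} {uA : ℝ → ℝ → ℝ} {uB : Y → (Fin N → ℝ) → ℝ}
    {γ : Measure (ℝ × (Fin N → ℝ))} [IsFiniteMeasure γ]
    (huB0 : ∀ b, uB y₀ b = 0)
    (h11 : ∀ x ∈ X, ∀ a ∈ ΘA, ∀ a' ∈ ΘA, a ≤ a' → uA x a ≤ uA x a')
    (hID : ∀ x ∈ X, ∀ x' ∈ X, x ≤ x' → ∀ a ∈ ΘA, ∀ a' ∈ ΘA, a ≤ a' →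
      uA x' a - uA x a ≤ uA x' a' - uA x a')
    {m : ℕ} {τ z : ℕ → ℝ} {c : ℝ → ℕ} (hc : Monotone c) (hcm : ∀ a, c a ≤ m)
    (hτ : ∀ j ≤ m, τ j ∈ ΘA) (hlo : ∀ a ∈ ΘA, ∀ k ≤ c a, τ k ≤ a)
    (hhi : ∀ a, ∀ k, c a < k → k ≤ m → a ≤ τ k)
    (hz : Monotone z) (hzX : ∀ j ≤ m, z j ∈ X) :
    Mechanism ΘA ΘB X uA uB γ (fun θ => z (c θ.1)) (fun _ => y₀)
      (fun θ => menuPrice uA τ z (c θ.1)) := by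
  have hcθ : Measurable fun θ : ℝ × (Fin N → ℝ) => c θ.1 := hc.measurable.comp measurable_fst
  have hIC : ∀ a ∈ ΘA, ∀ j ≤ m,
      uA (z j) a - menuPrice uA τ z j ≤ uA (z (c a)) a - menuPrice uA τ z (c a) :=
    fun a ha j hj => sub_menuPrice_le hID hz hzX hτ ha (hcm a) (hlo a ha) (hhi a) hj
  refine ⟨(measurable_of_countable z).comp hcθ, measurable_const,
    (measurable_of_countable (menuPrice uA τ z)).comp hcθ, ?_, fun θ _ => hzX _ (hcm _),
    fun θ hθ θ' _ => ?_, fun θ hθ => ?_⟩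
  · refine integrable_of_abs_le ((measurable_of_countable (menuPrice uA τ z)).comp hcθ)
      (C := ∑ j ∈ Finset.range (m + 1), |menuPrice uA τ z j|) (ae_of_all _ fun θ => ?_)
    exact Finset.single_le_sum (f := fun j => |menuPrice uA τ z j|) (fun j _ => abs_nonneg _)
      (Finset.mem_range.2 (Nat.lt_succ_of_le (hcm θ.1)))
  · have := hIC θ.1 hθ.1 (c θ'.1) (hcm _)
    linarith
  · have h0 := hIC θ.1 hθ.1 0 (Nat.zero_le _)
    have h1 := h11 _ (hzX 0 (Nat.zero_le _)) _ (hτ 0 (Nat.zero_le _)) _ hθ.1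
      (hlo _ hθ.1 0 (Nat.zero_le _))
    rw [menuPrice] at h0
    simp only [huB0]
    linarith

lemma exists_measurable_eq_of_continuousOn {α : Type*} [MeasurableSpace α] {f : ℝ → ℝ → ℝ}
    {X A : Set ℝ} (hX : IsCompact X) (hA : IsCompact A)
    (hf : ContinuousOn (fun p : ℝ × ℝ => f p.1 p.2) (X ×ˢ A)) {x a : α → ℝ} (hx : Measurable x)
    (ha : Measurable a) :
    ∃ g : α → ℝ, Measurable g ∧ ∀ ω, x ω ∈ X → a ω ∈ A → g ω = f (x ω) (a ω) := by
  classical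
  refine ⟨fun ω => (X ×ˢ A).piecewise (fun p : ℝ × ℝ => f p.1 p.2) (fun _ => 0) (x ω, a ω),
    (hf.measurable_piecewise continuousOn_const (hX.prod hA).measurableSet).comp (hx.prodMk ha),
    fun ω hxω haω => ?_⟩
  exact piecewise_eq_of_mem _ _ _ (show (x ω, a ω) ∈ X ×ˢ A from ⟨hxω, haω⟩)

section

variable {ΘA : Set ℝ} {ΘB : Set (Fin N → ℝ)} {X : Set ℝ}
  {γ : Measure (ℝ × (Fin N → ℝ))} {uA vA : ℝ → ℝ → ℝ}
  {uB vB : Y → (Fin N → ℝ) → ℝ} {x : ℝ × (Fin N → ℝ) → ℝ} {y : ℝ × (Fin N → ℝ) → Y}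
  {t : ℝ × (Fin N → ℝ) → ℝ}

lemma Mechanism.exists_abs_transfer_le (hΘA : IsCompact ΘA) (hX : IsCompact X)
    (huAc : ContinuousOn (fun p : ℝ × ℝ => uA p.1 p.2) (X ×ˢ ΘA))
    (huBbdd : ∃ M, ∀ y, ∀ b ∈ ΘB, |uB y b| ≤ M) (hM : Mechanism ΘA ΘB X uA uB γ x y t) :
    ∃ C, ∀ θ ∈ ΘA ×ˢ ΘB, |t θ| ≤ C := by
  obtain ⟨-, -, -, -, hxX, hIC, hIR⟩ := hM
  obtain ⟨M, hM⟩ := huBbdd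
  obtain ⟨C, hC⟩ := exists_abs_le_of_continuousOn hX hΘA huAc
  rcases (ΘA ×ˢ ΘB).eq_empty_or_nonempty with h | ⟨θ₀, hθ₀⟩
  · exact ⟨0, by simp [h]⟩
  refine ⟨|t θ₀| + 2 * (C + M), fun θ hθ => ?_⟩
  have hθ₀t := abs_le.1 (le_refl |t θ₀|)
  have h1 := abs_le.1 (hC _ (hxX θ hθ) _ hθ.1)
  have h2 := abs_le.1 (hM (y θ) _ hθ.2)
  have h3 := abs_le.1 (hC _ (hxX θ₀ hθ₀) _ hθ₀.1)
  have h4 := abs_le.1 (hM (y θ₀) _ hθ₀.2)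
  have h5 := abs_le.1 (hC _ (hxX θ hθ) _ hθ₀.1)
  have h6 := abs_le.1 (hM (y θ) _ hθ₀.2)
  have h7 := hIR θ hθ
  have h8 := hIC θ₀ hθ₀ θ hθ
  refine abs_le.2 ⟨?_, ?_⟩ <;> linarith

variable [IsProbabilityMeasure γ]

lemma integrable_comp_of_bounded (hγ : ∀ᵐ θ ∂γ, θ ∈ ΘA ×ˢ ΘB)
    (huBmeas : Measurable (fun p : Y × (Fin N → ℝ) => uB p.1 p.2))
    (huBbdd : ∃ M, ∀ y, ∀ b ∈ ΘB, |uB y b| ≤ M) (hy : Measurable y) :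
    Integrable (fun θ => uB (y θ) θ.2) γ := by
  obtain ⟨M, hM⟩ := huBbdd
  exact integrable_of_abs_le (huBmeas.comp (hy.prodMk measurable_snd))
    (hγ.mono fun θ hθ => hM _ _ hθ.2)

lemma integrable_comp_of_continuousOn (hΘA : IsCompact ΘA) (hX : IsCompact X)
    (hγ : ∀ᵐ θ ∂γ, θ ∈ ΘA ×ˢ ΘB)
    (hvAc : ContinuousOn (fun p : ℝ × ℝ => vA p.1 p.2) (X ×ˢ ΘA)) (hx : Measurable x)
    (hxX : ∀ θ ∈ ΘA ×ˢ ΘB, x θ ∈ X) : Integrable (fun θ => vA (x θ) θ.1) γ := by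
  obtain ⟨g, hg, hgv⟩ := exists_measurable_eq_of_continuousOn hX hΘA hvAc hx measurable_fst
  obtain ⟨C, hC⟩ := exists_abs_le_of_continuousOn hX hΘA hvAc
  have hgi : Integrable g γ := integrable_of_abs_le hg (C := C) <| hγ.mono fun θ hθ => by
    rw [hgv θ (hxX θ hθ) hθ.1]
    exact hC _ (hxX θ hθ) _ hθ.1
  exact hgi.congr (hγ.mono fun θ hθ => hgv θ (hxX θ hθ) hθ.1)

/-- An upper bound on the payoffs of all mechanisms that do not use the instruments also bounds
the payoff of any mechanism, gross of the surplus of the instruments. -/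
lemma Mechanism.payoff_sub_integral_le {y₀ : Y} (hΘA : IsCompact ΘA) (hΘB : IsCompact ΘB)
    (hX : IsCompact X) (hγ : ∀ᵐ θ ∂γ, θ ∈ ΘA ×ˢ ΘB)
    (huAc : ContinuousOn (fun p : ℝ × ℝ => uA p.1 p.2) (X ×ˢ ΘA))
    (hvAc : ContinuousOn (fun p : ℝ × ℝ => vA p.1 p.2) (X ×ˢ ΘA))
    (huBmeas : Measurable (fun p : Y × (Fin N → ℝ) => uB p.1 p.2))
    (hvBmeas : Measurable (fun p : Y × (Fin N → ℝ) => vB p.1 p.2))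
    (huBbdd : ∃ M, ∀ y, ∀ b ∈ ΘB, |uB y b| ≤ M)
    (hvBbdd : ∃ M, ∀ y, ∀ b ∈ ΘB, |vB y b| ≤ M)
    (huB0 : ∀ b, uB y₀ b = 0) (hvB0 : ∀ b, vB y₀ b = 0)
    (h11 : ∀ x ∈ X, ∀ a ∈ ΘA, ∀ a' ∈ ΘA, a ≤ a' → uA x a ≤ uA x a')
    (h12 : ∀ x ∈ X, ∀ x' ∈ X, x < x' → ∀ a ∈ ΘA, ∀ a' ∈ ΘA, a < a' →
      uA x' a - uA x a < uA x' a' - uA x a')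
    (h13 : ∀ x ∈ X, ∀ x' ∈ X, x < x' → ∀ a ∈ ΘA, ∀ a' ∈ ΘA, a < a' →
      0 < (uA x' a + vA x' a) - (uA x a + vA x a) →
      0 < (uA x' a' + vA x' a') - (uA x a' + vA x a'))
    (h21 : ∀ y : Y, ∀ b ∈ ΘB, ∀ b' ∈ ΘB, b ≤ b' → uB y b ≤ uB y b')
    {κ : Kernel ℝ (Fin N → ℝ)} (hκ : IsRCD γ κ)
    (hmono : ∀ a ∈ MSupport γ.fst, ∀ a' ∈ MSupport γ.fst, a < a' →
      ∀ f : (Fin N → ℝ) → ℝ, Measurable f → Monotone f → (∃ M, ∀ b, |f b| ≤ M) →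
        ∫ b, f b ∂(κ a) ≤ ∫ b, f b ∂(κ a'))
    (hM : Mechanism ΘA ΘB X uA uB γ x y t) {P : ℝ}
    (hP : ∀ x' t', Mechanism ΘA ΘB X uA uB γ x' (fun _ => y₀) t' →
      Payoff vA vB γ x' (fun _ => y₀) t' ≤ P) :
    Payoff vA vB γ x y t - ∫ θ, (uB (y θ) θ.2 + vB (y θ) θ.2) ∂γ ≤ P := by
  obtain ⟨hx, hy, ht, hti, hxX, hIC, hIR⟩ := id hM
  obtain ⟨θ₀, hθ₀⟩ := hγ.exists
  have hID : ∀ x ∈ X, ∀ x' ∈ X, x ≤ x' → ∀ a ∈ ΘA, ∀ a' ∈ ΘA, a ≤ a' →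
      uA x' a - uA x a ≤ uA x' a' - uA x a' := by
    intro x hx x' hx' hxx a ha a' ha' haa
    rcases hxx.eq_or_lt with rfl | h
    · simp
    rcases haa.eq_or_lt with rfl | h'
    · exact le_rfl
    exact (h12 x hx x' hx' h a ha a' ha' h').le
  have hvAi := integrable_comp_of_continuousOn hΘA hX hγ hvAc hx hxX
  have huBi := integrable_comp_of_bounded hγ huBmeas huBbdd hy
  have hvBi := integrable_comp_of_bounded hγ hvBmeas hvBbdd hy
  obtain ⟨g, hg, hgv⟩ := exists_measurable_eq_of_continuousOn hX hΘA hvAc hx measurable_fst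
  set h : ℝ × (Fin N → ℝ) → ℝ := fun θ => g θ - uB (y θ) θ.2 + t θ with h_def
  have hhm : Measurable h := (hg.sub (huBmeas.comp (hy.prodMk measurable_snd))).add ht
  have hhΘ : ∀ θ ∈ ΘA ×ˢ ΘB, h θ = vA (x θ) θ.1 - uB (y θ) θ.2 + t θ := fun θ hθ => by
    rw [h_def]
    simp only [hgv θ (hxX θ hθ) hθ.1]
  have hhC : ∃ C, ∀ θ ∈ ΘA ×ˢ ΘB, |h θ| ≤ C := by
    obtain ⟨C₁, hC₁⟩ := exists_abs_le_of_continuousOn hX hΘA hvAc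
    obtain ⟨C₂, hC₂⟩ := huBbdd
    obtain ⟨C₃, hC₃⟩ := hM.exists_abs_transfer_le hΘA hX huAc ⟨C₂, hC₂⟩
    refine ⟨C₁ + C₂ + C₃, fun θ hθ => ?_⟩
    have h1 := abs_le.1 (hC₁ _ (hxX θ hθ) _ hθ.1)
    have h2 := abs_le.1 (hC₂ (y θ) _ hθ.2)
    have h3 := abs_le.1 (hC₃ θ hθ)
    rw [hhΘ θ hθ]
    refine abs_le.2 ⟨?_, ?_⟩ <;> linarith
  obtain ⟨C, hC⟩ := hhC
  have hhi : Integrable h γ := integrable_of_abs_le hhm (hγ.mono hC)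
  have hhint : Payoff vA vB γ x y t - ∫ θ, (uB (y θ) θ.2 + vB (y θ) θ.2) ∂γ = ∫ θ, h θ ∂γ := by
    rw [Payoff]
    refine (integral_sub ((hvAi.add hvBi).add hti) (huBi.add hvBi)).symm.trans
      (integral_congr_ae (hγ.mono fun θ hθ => ?_))
    simp only [hhΘ θ hθ, Pi.add_apply]
    ring
  rw [hhint]
  refine le_of_forall_pos_le_add fun ε hε => ?_
  obtain ⟨η, hη, rfl⟩ : ∃ η > 0, ε = 3 * η := ⟨ε / 3, by positivity, by ring⟩
  obtain ⟨δ₁, hδ₁, hs⟩ := exists_pos_forall_abs_sub_lt (f := fun x a => uA x a + vA x a) hX hΘA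
    (huAc.add hvAc) hη
  obtain ⟨F, hFX, hFnet⟩ := exists_finset_left_net hX hδ₁
  set ω : ℝ := η / (F.card + 1) with hω_def
  have hω : 0 < ω := by positivity
  obtain ⟨δ₂, hδ₂, huδ⟩ := exists_pos_forall_abs_sub_lt hX hΘA huAc hω
  obtain ⟨δ₃, hδ₃, hvδ⟩ := exists_pos_forall_abs_sub_lt hX hΘA hvAc hη
  obtain ⟨m, τ, c, hc, hcm, hτ, hcτ, hlo, hhi', hcδ⟩ :=
    exists_cells hΘA ⟨_, hθ₀.1⟩ (lt_min hδ₂ hδ₃)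
  have hcθ : Measurable fun θ : ℝ × (Fin N → ℝ) => c θ.1 := hc.measurable.comp measurable_fst
  have hcm' : ∀ θ : ℝ × (Fin N → ℝ), c θ.1 < m + 1 := fun θ => Nat.lt_succ_of_le (hcm _)
  rw [← sum_setIntegral_fiber hcθ hcm' hhi]
  refine sum_setIntegral_le_of_forall_path hκ hmono hΘA hΘB ⟨_, hθ₀.2⟩ hγ hc
    (fun j hj => ⟨τ j, hτ j (by omega), hcτ j (by omega)⟩) hhm hC fun θ hθ hθB => ?_
  have hθΘ : ∀ j ≤ m, θ j ∈ ΘA ×ˢ ΘB := fun j hj => (hθ j (by omega)).1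
  have hθc : ∀ j ≤ m, c (θ j).1 = j := fun j hj => (hθ j (by omega)).2
  have hlt : ∀ j k, j < k → k ≤ m → (θ j).1 < (θ k).1 := fun j k hjk hk => by
    refine hc.reflect_lt ?_
    rwa [hθc j (by omega), hθc k hk]
  have hτθ : ∀ j ≤ m, τ j ≤ (θ j).1 := fun j hj =>
    hlo _ (hθΘ j hj).1 j (hθc j hj).ge
  have hθδ : ∀ j ≤ m, (θ j).1 < τ j + min δ₂ δ₃ := fun j hj => by
    simpa only [hθc j hj] using hcδ _ (hθΘ j hj).1
  obtain ⟨z, hz, hzX, hzu⟩ := exists_menu (u := uA) (s := fun x a => uA x a + vA x a)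
    (v := fun j => uA (x (θ j)) (θ j).1 + uB (y (θ j)) (θ j).2 - t (θ j))
    (x := fun j => x (θ j)) (a := fun j => (θ j).1) (η := η) (ω := ω) hFX h11 hID h13
    (fun j hj => hxX _ (hθΘ j hj)) hτ (fun j hj => (hθΘ j hj).1) hτθ hlt hω.le
    (by rw [hω_def, div_mul_cancel₀ _ (by positivity)])
    (fun x hx => by
      obtain ⟨f, hf, hfx, hxf⟩ := hFnet x hx
      refine ⟨f, hf, hfx, fun a ha => ?_⟩
      have := abs_lt.1 (hs x hx f (hFX f hf) a ha a ha
        (by rw [abs_lt]; constructor <;> linarith) (by simpa using hδ₁))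
      linarith)
    (fun x hx j hj => by
      have h1 := hθδ j hj
      have h2 := hτθ j hj
      have h3 := min_le_left δ₂ δ₃
      exact (le_abs_self _).trans (huδ x hx x hx _ (hθΘ j hj).1 _ (hτ j hj) (by simpa using hδ₂)
        (by rw [abs_lt]; constructor <;> linarith)).le)
    (hIR _ (hθΘ 0 (by omega)))
    (fun j k hjk hk => by
      have h1 := hIC _ (hθΘ k hk) _ (hθΘ j (by omega))
      have h2 := h21 (y (θ j)) _ (hθΘ j (by omega)).2 _ (hθΘ k hk).2 (hθB j k hjk (by omega))
      linarith)
  have hmenu : Mechanism ΘA ΘB X uA uB γ (fun θ => z (c θ.1)) (fun _ => y₀)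
      (fun θ => menuPrice uA τ z (c θ.1)) :=
    mechanism_menu huB0 h11 hID hc hcm hτ hlo hhi' hz hzX
  have hpay : Integrable (fun θ : ℝ × (Fin N → ℝ) =>
      vA (z (c θ.1)) θ.1 + vB y₀ θ.2 + menuPrice uA τ z (c θ.1)) γ :=
    ((integrable_comp_of_continuousOn hΘA hX hγ hvAc hmenu.1 hmenu.2.2.2.2.1).add
      (integrable_comp_of_bounded hγ hvBmeas hvBbdd hmenu.2.1)).add hmenu.2.2.2.1
  refine (sum_measureReal_fiber_mul_le hcθ hcm' (φ := fun j => h (θ j)) (ε := 3 * η) hpay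
    (hγ.mono fun θ' hθ' => ?_)).trans (add_le_add_left (hP _ _ hmenu) _)
  obtain ⟨i, hi⟩ : ∃ i, c θ'.1 = i := ⟨_, rfl⟩
  have him : i ≤ m := hi ▸ hcm _
  obtain ⟨h1, h2⟩ := hzu i him
  have h3 := hcδ _ hθ'.1
  have h4 := hlo _ hθ'.1 i hi.ge
  have h5 := hθδ i him
  have h6 := hτθ i him
  have h7 := min_le_right δ₂ δ₃
  rw [hi] at h3
  have h8 := abs_lt.1 (hvδ _ (hzX i him) _ (hzX i him) _ hθ'.1 _ (hθΘ i him).1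
    (by simpa using hδ₃) (by rw [abs_lt]; constructor <;> linarith))
  simp only [hi, hhΘ _ (hθΘ i him), hvB0]
  linarith

end

/-- **Theorem 1(ii).** Under Assumptions 1 and 2, if the instruments are strictly
costly, then every optimal mechanism almost surely involves no costly screening. -/
theorem stmt1
    (y₀ : Y) (hy₀ : MeasurableSet ({y₀} : Set Y))
    (ΘA : Set ℝ) (ΘB : Set (Fin N → ℝ)) (X : Set ℝ)
    (hΘA : IsCompact ΘA) (hΘB : IsCompact ΘB) (hX : IsCompact X) (hXne : X.Nonempty)
    (γ : Measure (ℝ × (Fin N → ℝ))) (hγp : IsProbabilityMeasure γ)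
    (hγsupp : γ ((ΘA ×ˢ ΘB)ᶜ) = 0)
    (uA vA : ℝ → ℝ → ℝ)
    (huAc : ContinuousOn (fun p : ℝ × ℝ => uA p.1 p.2) (X ×ˢ ΘA))
    (hvAc : ContinuousOn (fun p : ℝ × ℝ => vA p.1 p.2) (X ×ˢ ΘA))
    (uB vB : Y → (Fin N → ℝ) → ℝ)
    (huBmeas : Measurable (fun p : Y × (Fin N → ℝ) => uB p.1 p.2))
    (hvBmeas : Measurable (fun p : Y × (Fin N → ℝ) => vB p.1 p.2))
    (huBbdd : ∃ M, ∀ y, ∀ b ∈ ΘB, |uB y b| ≤ M)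
    (hvBbdd : ∃ M, ∀ y, ∀ b ∈ ΘB, |vB y b| ≤ M)
    -- the instruments are (weakly) costly
    (hsB : ∀ y, ∀ b ∈ ΘB, uB y b + vB y b ≤ 0)
    -- the instruments are strictly costly
    (hsBstrict : ∀ y : Y, y ≠ y₀ → ∀ b ∈ ΘB, uB y b + vB y b < 0)
    (huB0 : ∀ b, uB y₀ b = 0) (hvB0 : ∀ b, vB y₀ b = 0)
    -- Assumption 1.1: uA nondecreasing in the type
    (h11 : ∀ x ∈ X, ∀ a ∈ ΘA, ∀ a' ∈ ΘA, a ≤ a' → uA x a ≤ uA x a')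
    -- Assumption 1.2: strict increasing differences
    (h12 : ∀ x ∈ X, ∀ x' ∈ X, x < x' → ∀ a ∈ ΘA, ∀ a' ∈ ΘA, a < a' →
      uA x' a - uA x a < uA x' a' - uA x a')
    -- Assumption 1.3: weak single-crossing differences of the surplus
    (h13 : ∀ x ∈ X, ∀ x' ∈ X, x < x' → ∀ a ∈ ΘA, ∀ a' ∈ ΘA, a < a' →
      0 < (uA x' a + vA x' a) - (uA x a + vA x a) →
      0 < (uA x' a' + vA x' a') - (uA x a' + vA x a'))
    -- Assumption 2.1: uB nondecreasing in the costly type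
    (h21 : ∀ y : Y, ∀ b ∈ ΘB, ∀ b' ∈ ΘB, b ≤ b' → uB y b ≤ uB y b')
    -- Assumption 2.2: θ^B stochastically nondecreasing in θ^A
    (h22 : ∃ κ : Kernel ℝ (Fin N → ℝ), IsRCD γ κ ∧
      ∀ a ∈ MSupport γ.fst, ∀ a' ∈ MSupport γ.fst, a < a' →
        ∀ f : (Fin N → ℝ) → ℝ, Measurable f → Monotone f →
          (∃ M, ∀ b, |f b| ≤ M) →
          ∫ b, f b ∂(κ a) ≤ ∫ b, f b ∂(κ a')) :
    ∀ x y t, Mechanism ΘA ΘB X uA uB γ x y t →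
      (∀ x' y' t', Mechanism ΘA ΘB X uA uB γ x' y' t' →
        Payoff vA vB γ x' y' t' ≤ Payoff vA vB γ x y t) →
      ∀ᵐ θ ∂γ, y θ = y₀ := by
  intro x y t hM hopt
  obtain ⟨κ, hκ, hmono⟩ := h22
  have hγ : ∀ᵐ θ ∂γ, θ ∈ ΘA ×ˢ ΘB := hγsupp
  have hle := hM.payoff_sub_integral_le hΘA hΘB hX hγ huAc hvAc huBmeas hvBmeas huBbdd hvBbdd
    huB0 hvB0 h11 h12 h13 h21 hκ hmono fun x' t' => hopt x' _ t'
  have hneg : ∀ᵐ θ ∂γ, 0 ≤ -(uB (y θ) θ.2 + vB (y θ) θ.2) :=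
    hγ.mono fun θ hθ => neg_nonneg.2 (hsB _ _ hθ.2)
  have hint : Integrable (fun θ => -(uB (y θ) θ.2 + vB (y θ) θ.2)) γ :=
    ((integrable_comp_of_bounded hγ huBmeas huBbdd hM.2.1).add
      (integrable_comp_of_bounded hγ hvBmeas hvBbdd hM.2.1)).neg
  have hzero : ∫ θ, -(uB (y θ) θ.2 + vB (y θ) θ.2) ∂γ = 0 := by
    refine le_antisymm ?_ (integral_nonneg_of_ae hneg)
    rw [integral_neg]
    linarith
  filter_upwards [hγ, (integral_eq_zero_iff_of_nonneg_ae hneg hint).1 hzero] with θ hθ h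
  by_contra hne
  have h' := hsBstrict _ hne _ hθ.2
  simp only [Pi.zero_apply] at h
  linarith
end
end

section
/- Consider a standard one-dimensional screening problem and suppose the surplus function s(x, θ) = u(x, θ) + v(x, θ) has weak single-crossing differences. Then there exists a mechanism (x*, t*) that attains the supremum of the principal's payoff over all measurable mechanisms satisfying the downward IC and IR constraints, and (x*, t*) satisfies all IC constraints (both downward and upward). -/
open MeasureTheory Set

noncomputable section

/-- A measurable mechanism satisfying the downward IC constraints and the IR
constraints in the standard one-dimensional screening problem (with integrable
transfer, so that the principal's payoff is well defined). -/
def DICMech (Θ X : Set ℝ) (u : ℝ → ℝ → ℝ) (μ : Measure ℝ)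
    (x t : ℝ → ℝ) : Prop :=
  Measurable x ∧ Measurable t ∧ Integrable t μ ∧
    (∀ a ∈ Θ, x a ∈ X) ∧
    (∀ a ∈ Θ, ∀ a' ∈ Θ, a' < a → u (x a) a - t a ≥ u (x a') a - t a') ∧
    (∀ a ∈ Θ, u (x a) a - t a ≥ 0)

/-- The principal's expected payoff. -/
def PPayoff (v : ℝ → ℝ → ℝ) (μ : Measure ℝ) (x t : ℝ → ℝ) : ℝ :=
  ∫ a, (v (x a) a + t a) ∂μ

open Filter Topology

/-- **Helly's selection theorem**: a uniformly bounded sequence of monotone functions has a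
subsequence converging pointwise to a monotone function. -/
theorem exists_subseq_tendsto_of_monotone {A B : ℝ} (f : ℕ → ℝ → ℝ) (hf : ∀ n, Monotone (f n))
    (hfb : ∀ n a, f n a ∈ Icc A B) :
    ∃ (L : ℝ → ℝ) (φ : ℕ → ℕ), StrictMono φ ∧ Monotone L ∧ (∀ a, L a ∈ Icc A B) ∧
      ∀ a, Tendsto (fun n => f (φ n) a) atTop (𝓝 (L a)) := by
  have hK : IsCompact ((univ.pi fun _ : ℝ => Icc A B) ∩ {g : ℝ → ℝ | Monotone g}) :=
    (isCompact_univ_pi fun _ => isCompact_Icc).inter_right isClosed_monotone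
  obtain ⟨L, ⟨hLb, hLm⟩, hL⟩ := hK.exists_mapClusterPt (f := atTop) (u := f)
    (tendsto_principal.2 (Eventually.of_forall fun n => ⟨fun a _ => hfb n a, hf n⟩))
  have hLm : Monotone L := hLm
  set D : Set ℝ := range ((↑) : ℚ → ℝ) ∪ {a | ¬ContinuousAt L a}
  have hD : D.Countable := (countable_range _).union hLm.countable_not_continuousAt
  have : Countable D := hD
  have hres : Continuous fun (g : ℝ → ℝ) (d : D) => g d :=
    continuous_pi fun d => continuous_apply _
  have hcl : MapClusterPt (fun d : D => L d) atTop (fun n (d : D) => f n d) :=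
    hL.continuousAt_comp (f := fun (g : ℝ → ℝ) (d : D) => g d) hres.continuousAt
  obtain ⟨φ, hφ, hlim⟩ := hcl.tendsto_subseq
  have hlimD : ∀ d ∈ D, Tendsto (fun n => f (φ n) d) atTop (𝓝 (L d)) := fun d hd =>
    (tendsto_pi_nhds.1 hlim) ⟨d, hd⟩
  refine ⟨L, φ, hφ, hLm, fun a => hLb a (mem_univ a), fun a => ?_⟩
  by_cases hc : ContinuousAt L a
  · refine tendsto_order.2 ⟨fun r hr => ?_, fun r hr => ?_⟩
    · obtain ⟨l, hla, hl⟩ := exists_Ioc_subset_of_mem_nhds (hc.eventually (lt_mem_nhds hr))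
        (exists_lt a)
      obtain ⟨q, hlq, hqa⟩ := exists_rat_btwn hla
      filter_upwards [(hlimD q (Or.inl ⟨q, rfl⟩)).eventually
        (lt_mem_nhds (hl ⟨hlq, hqa.le⟩))] with n hn
      exact hn.trans_le (hf _ hqa.le)
    · obtain ⟨l, hla, hl⟩ := exists_Ico_subset_of_mem_nhds (hc.eventually (gt_mem_nhds hr))
        (exists_gt a)
      obtain ⟨q, haq, hql⟩ := exists_rat_btwn hla
      filter_upwards [(hlimD q (Or.inl ⟨q, rfl⟩)).eventually
        (gt_mem_nhds (hl ⟨haq.le, hql⟩))] with n hn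
      exact (hf _ haq.le).trans_lt hn
  · exact hlimD a (Or.inr hc)

/-- A bounded monotone function on a set extends to a monotone function on the line with the
same bounds. -/
theorem exists_monotone_extension_Icc {A B : ℝ} (hAB : A ≤ B) {f : ℝ → ℝ} {s : Set ℝ}
    (hf : MonotoneOn f s) (hfb : ∀ a ∈ s, f a ∈ Icc A B) :
    ∃ g : ℝ → ℝ, Monotone g ∧ (∀ a, g a ∈ Icc A B) ∧ EqOn f g s := by
  obtain ⟨g, hg, hfg⟩ := hf.exists_monotone_extension
    ⟨A, forall_mem_image.2 fun a ha => (hfb a ha).1⟩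
    ⟨B, forall_mem_image.2 fun a ha => (hfb a ha).2⟩
  refine ⟨fun a => max A (min B (g a)), fun a b hab => max_le_max le_rfl
    (min_le_min le_rfl (hg hab)), fun a => ⟨le_max_left _ _, max_le hAB (min_le_left _ _)⟩,
    fun a ha => ?_⟩
  have := hfb a ha
  rw [hfg ha] at this
  simp only [hfg ha, min_eq_right this.2, max_eq_right this.1]

/-- Weakly increasing differences of `u` on `X × Θ`. -/
def IncDiff (Θ X : Set ℝ) (u : ℝ → ℝ → ℝ) : Prop :=
  ∀ y ∈ X, ∀ z ∈ X, y ≤ z → ∀ a ∈ Θ, ∀ b ∈ Θ, a ≤ b → u y b - u y a ≤ u z b - u z a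

/-- The rent function `U` satisfies IR and, with the allocation `x`, the downward IC
constraints. -/
def DownwardRent (Θ : Set ℝ) (u : ℝ → ℝ → ℝ) (x U : ℝ → ℝ) : Prop :=
  (∀ a ∈ Θ, 0 ≤ U a) ∧
    ∀ a ∈ Θ, ∀ a' ∈ Θ, a' < a → U a' + (u (x a') a - u (x a') a') ≤ U a

/-- The pointwise infimum of all rents satisfying IR and the downward IC constraints for the
allocation `x`. -/
def minRent (Θ : Set ℝ) (u : ℝ → ℝ → ℝ) (x : ℝ → ℝ) (a : ℝ) : ℝ :=
  sInf ((fun U : ℝ → ℝ => U a) '' {U | DownwardRent Θ u x U})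

section Rents

variable {Θ X : Set ℝ} {u : ℝ → ℝ → ℝ} {x U : ℝ → ℝ}

theorem minRent_le (hU : DownwardRent Θ u x U) {a : ℝ} (ha : a ∈ Θ) :
    minRent Θ u x a ≤ U a :=
  csInf_le ⟨0, forall_mem_image.2 fun _ hV => hV.1 a ha⟩ ⟨U, hU, rfl⟩

theorem downwardRent_minRent (hU : DownwardRent Θ u x U) :
    DownwardRent Θ u x (minRent Θ u x) := by
  refine ⟨fun a ha => le_csInf ⟨_, U, hU, rfl⟩ (forall_mem_image.2 fun _ hV => hV.1 a ha),
    fun a ha a' ha' h => le_csInf ⟨_, U, hU, rfl⟩ (forall_mem_image.2 fun V hV => ?_)⟩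
  have h1 := hV.2 a ha a' ha' h
  have h2 := minRent_le hV ha'
  linarith

/-- An upper bound for the minimal rent on a set `S` of types, obtained by lowering the minimal
rent to `g` on `S` whenever this preserves feasibility. -/
theorem minRent_le_of_lowering (hU : DownwardRent Θ u x U) (S : Set ℝ) (g : ℝ → ℝ)
    (hg : ∀ k ∈ Θ, k ∈ S → 0 ≤ g k)
    (hstep : ∀ k ∈ Θ, k ∈ S → ∀ k' ∈ Θ, k' < k →
      minRent Θ u x k' + (u (x k') k - u (x k') k') ≤ g k ∨
        k' ∈ S ∧ g k' + (u (x k') k - u (x k') k') ≤ g k)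
    {k : ℝ} (hk : k ∈ Θ) (hkS : k ∈ S) : minRent Θ u x k ≤ g k := by
  classical
  have hW := downwardRent_minRent hU
  set W := minRent Θ u x
  let W' : ℝ → ℝ := fun k => if k ∈ S then min (W k) (g k) else W k
  have hle : ∀ k, W' k ≤ W k := fun k => by
    by_cases h : k ∈ S <;> simp [W', h]
  have hle' : ∀ k ∈ S, W' k ≤ g k := fun k h => by simp [W', h]
  have hge : ∀ r k, r ≤ W k → (k ∈ S → r ≤ g k) → r ≤ W' k := fun r k h1 h2 => by
    by_cases h : k ∈ S
    · simp [W', h, h1, h2 h]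
    · simp [W', h, h1]
  have hW' : DownwardRent Θ u x W' := by
    refine ⟨fun a ha => hge _ _ (hW.1 a ha) (hg a ha), fun a ha a' ha' h => hge _ _ ?_ ?_⟩
    · have := hW.2 a ha a' ha' h
      linarith [hle a']
    · intro haS
      rcases hstep a ha haS a' ha' h with h1 | ⟨h1, h2⟩
      · linarith [hle a']
      · linarith [hle' a' h1]
  exact (minRent_le hW' hk).trans (hle' k hkS)

/-- For a monotone allocation, the minimal rent also satisfies the upward IC constraints. -/
theorem minRent_upward (humono : ∀ y ∈ X, ∀ a ∈ Θ, ∀ a' ∈ Θ, a ≤ a' → u y a ≤ u y a')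
    (hID : IncDiff Θ X u) (hxX : ∀ a ∈ Θ, x a ∈ X) (hx : MonotoneOn x Θ)
    (hU : DownwardRent Θ u x U) {k a : ℝ} (hk : k ∈ Θ) (ha : a ∈ Θ) (hka : k ≤ a) :
    minRent Θ u x a + (u (x a) k - u (x a) a) ≤ minRent Θ u x k := by
  have hW := downwardRent_minRent hU
  have := minRent_le_of_lowering hU (Ici k)
    (fun a => minRent Θ u x k + (u (x a) a - u (x a) k))
    (fun a ha hka => by linarith [hW.1 k hk, humono _ (hxX a ha) k hk a ha hka])
    (fun a ha hka a' ha' haa => by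
      have hxx := hx ha' ha haa.le
      rcases lt_or_ge a' k with h | h
      · left
        linarith [hW.2 k hk a' ha' h, hID _ (hxX _ ha') _ (hxX _ ha) hxx k hk a ha hka]
      · right
        exact ⟨h, by linarith [hID _ (hxX _ ha') _ (hxX _ ha) hxx k hk a ha hka]⟩) ha hka
  linarith

/-- The minimal rent satisfies the downward IC constraints even when type `k` is assigned the
allocation of any lower type `b`. -/
theorem minRent_downward_of_le
    (humono : ∀ y ∈ X, ∀ a ∈ Θ, ∀ a' ∈ Θ, a ≤ a' → u y a ≤ u y a')
    (hID : IncDiff Θ X u) (hxX : ∀ a ∈ Θ, x a ∈ X)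
    (hU : DownwardRent Θ u x U) {b k a : ℝ} (hb : b ∈ Θ) (hk : k ∈ Θ) (ha : a ∈ Θ)
    (hbk : b ≤ k) (hka : k < a) :
    minRent Θ u x k + (u (x b) a - u (x b) k) ≤ minRent Θ u x a := by
  have hW := downwardRent_minRent hU
  have hWa := hW.2 a ha b hb (hbk.trans_lt hka)
  have := minRent_le_of_lowering hU (Ico b a)
    (fun k => minRent Θ u x a - (u (x b) a - u (x b) k))
    (fun k hk hkS => by linarith [hW.1 b hb, humono _ (hxX b hb) b hb k hk hkS.1])
    (fun k hk hkS k' hk' hkk => by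
      rcases le_total (x b) (x k') with hx | hx
      · left
        linarith [hW.2 a ha k' hk' (hkk.trans hkS.2),
          hID _ (hxX _ hb) _ (hxX _ hk') hx k hk a ha hkS.2.le]
      · rcases lt_or_ge k' b with h | h
        · left
          linarith [hW.2 b hb k' hk' h, hID _ (hxX _ hk') _ (hxX _ hb) hx b hb k hk hkS.1]
        · right
          exact ⟨⟨h, hkk.trans hkS.2⟩, by
            linarith [hID _ (hxX _ hk') _ (hxX _ hb) hx k' hk' k hk hkk.le]⟩) hk ⟨hbk, hka⟩
  linarith

/-- A monotone allocation `x` and a monotone rent `W`, uniformly bounded, satisfying IR and all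
IC constraints on `Θ`. -/
structure MonotoneIC (Θ X : Set ℝ) (u : ℝ → ℝ → ℝ) (A B M : ℝ) (x W : ℝ → ℝ) : Prop where
  monotone_alloc : Monotone x
  monotone_rent : Monotone W
  alloc_mem_Icc : ∀ a, x a ∈ Icc A B
  rent_mem_Icc : ∀ a, W a ∈ Icc 0 M
  alloc_mem : ∀ a ∈ Θ, x a ∈ X
  ic : ∀ a ∈ Θ, ∀ a' ∈ Θ, W a' + (u (x a') a - u (x a') a') ≤ W a

/-- Any allocation with a rent satisfying the downward IC and IR constraints is dominated in
virtual surplus, type by type, by a monotone fully incentive compatible one. -/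
theorem exists_monotoneIC_ge (hX : IsCompact X) {s : ℝ → ℝ → ℝ}
    {a₀ a₁ A B : ℝ} (ha₀ : IsLeast Θ a₀) (ha₁ : IsGreatest Θ a₁)
    (hA : IsLeast X A) (hB : IsGreatest X B)
    (huc : Continuous fun p : ℝ × ℝ => u p.1 p.2) (hsc : Continuous fun p : ℝ × ℝ => s p.1 p.2)
    (humono : ∀ y ∈ X, ∀ a ∈ Θ, ∀ a' ∈ Θ, a ≤ a' → u y a ≤ u y a')
    (hID : IncDiff Θ X u)
    (hs : ∀ y ∈ X, ∀ z ∈ X, y < z → ∀ a ∈ Θ, ∀ a' ∈ Θ, a < a' →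
      0 < s z a - s y a → 0 < s z a' - s y a')
    (hxX : ∀ a ∈ Θ, x a ∈ X) (hU : DownwardRent Θ u x U) :
    ∃ y W : ℝ → ℝ, MonotoneIC Θ X u A B (u B a₁ - u B a₀) y W ∧
      ∀ a ∈ Θ, s (x a) a - U a ≤ s (y a) a - W a := by
  set m : ℝ → ℝ := fun a => sSup (x '' (Θ ∩ Iic a))
  have hbdd : ∀ a, BddAbove (x '' (Θ ∩ Iic a)) := fun a =>
    ⟨B, forall_mem_image.2 fun b hb => hB.2 (hxX b hb.1)⟩
  have hne : ∀ a ∈ Θ, (x '' (Θ ∩ Iic a)).Nonempty := fun a ha => ⟨_, a, ⟨ha, self_mem_Iic⟩, rfl⟩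
  have hcl : ∀ a ∈ Θ, m a ∈ closure (x '' (Θ ∩ Iic a)) := fun a ha =>
    csSup_mem_closure (hne a ha) (hbdd a)
  have hmX : ∀ a ∈ Θ, m a ∈ X := fun a ha =>
    closure_minimal (image_subset_iff.2 fun b hb => hxX b hb.1) hX.isClosed (hcl a ha)
  have hxm : ∀ a ∈ Θ, x a ≤ m a := fun a ha => le_csSup (hbdd a) ⟨a, ⟨ha, self_mem_Iic⟩, rfl⟩
  have hmm : ∀ a ∈ Θ, ∀ b, a ≤ b → m a ≤ m b := fun a ha b hab =>
    csSup_le_csSup (hbdd b) (hne a ha)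
      (image_mono (inter_subset_inter_right _ (Iic_subset_Iic.2 hab)))
  have hW := downwardRent_minRent hU
  have hWm : ∀ k ∈ Θ, ∀ a ∈ Θ, k < a →
      minRent Θ u x k + (u (m k) a - u (m k) k) ≤ minRent Θ u x a := by
    intro k hk a ha hka
    have hclosed : IsClosed {y | minRent Θ u x k + (u y a - u y k) ≤ minRent Θ u x a} := by
      have h1 : Continuous fun y => u y a := huc.comp (by fun_prop : Continuous fun y => (y, a))
      have h2 : Continuous fun y => u y k := huc.comp (by fun_prop : Continuous fun y => (y, k))
      exact isClosed_le (by fun_prop) continuous_const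
    have hsub : x '' (Θ ∩ Iic k) ⊆
        {y | minRent Θ u x k + (u y a - u y k) ≤ minRent Θ u x a} :=
      image_subset_iff.2 fun b hb =>
        minRent_downward_of_le humono hID hxX hU hb.1 hk ha hb.2 hka
    exact closure_minimal hsub hclosed (hcl k hk)
  have hsa : ∀ a, Continuous fun y => s y a := fun a =>
    hsc.comp (by fun_prop : Continuous fun y => (y, a))
  have hex : ∀ a ∈ Θ, ∃ y ∈ X, y ≤ m a ∧ (∀ z ∈ X, z ≤ m a → s z a ≤ s y a) ∧
      ∀ z ∈ X, z < y → s z a < s y a := by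
    intro a ha
    have hK : IsCompact (X ∩ Iic (m a)) := hX.inter_right isClosed_Iic
    obtain ⟨y, hy, hymax⟩ := hK.exists_isMaxOn ⟨m a, hmX a ha, self_mem_Iic⟩ (hsa a).continuousOn
    obtain ⟨w, ⟨hwK, hw⟩, hwl⟩ := (hK.inter_right
      (isClosed_le continuous_const (hsa a) : IsClosed {w | s y a ≤ s w a})).exists_isLeast
      ⟨y, hy, le_refl (s y a)⟩
    have hw : s y a ≤ s w a := hw
    refine ⟨w, hwK.1, hwK.2, fun z hz hzm => (hymax ⟨hz, hzm⟩).trans hw, fun z hz hzw => ?_⟩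
    by_contra! h
    exact hzw.not_ge (hwl ⟨⟨hz, hzw.le.trans hwK.2⟩, hw.trans h⟩)
  choose! y hyX hym hymax hymin using hex
  have hymono : MonotoneOn y Θ := by
    intro a ha b hb hab
    rcases hab.eq_or_lt with rfl | hab
    · exact le_rfl
    by_contra! h
    have h1 := hs _ (hyX b hb) _ (hyX a ha) h a ha b hb hab
      (sub_pos.2 (hymin a ha _ (hyX b hb) h))
    linarith [hymax b hb _ (hyX a ha) ((hym a ha).trans (hmm a ha b hab.le))]
  have hWy : DownwardRent Θ u y (minRent Θ u x) := by
    refine ⟨hW.1, fun a ha k hk hka => ?_⟩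
    linarith [hWm k hk a ha hka, hID _ (hyX k hk) _ (hmX k hk) (hym k hk) k hk a ha hka.le]
  have hV := downwardRent_minRent hWy
  have hVmono : MonotoneOn (minRent Θ u y) Θ := by
    intro a ha b hb hab
    rcases hab.eq_or_lt with rfl | hab
    · exact le_rfl
    linarith [hV.2 b hb a ha hab, humono _ (hyX a ha) a ha b hb hab.le]
  have hVB : ∀ a ∈ Θ, minRent Θ u y a ≤ u B a₁ - u B a₀ := by
    intro a ha
    have hfeas : DownwardRent Θ u y fun a => u B a - u B a₀ := by
      refine ⟨fun a ha => sub_nonneg.2 (humono B hB.1 _ ha₀.1 _ ha (ha₀.2 ha)),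
        fun a ha k hk hka => ?_⟩
      linarith [hID _ (hyX k hk) B hB.1 (hB.2 (hyX k hk)) k hk a ha hka.le]
    linarith [minRent_le hfeas ha, humono B hB.1 a ha a₁ ha₁.1 (ha₁.2 ha)]
  have hVic : ∀ a ∈ Θ, ∀ a' ∈ Θ,
      minRent Θ u y a' + (u (y a') a - u (y a') a') ≤ minRent Θ u y a := by
    intro a ha a' ha'
    rcases lt_or_ge a' a with h | h
    · exact hV.2 a ha a' ha' h
    · exact minRent_upward humono hID hyX hymono hWy ha ha' h
  obtain ⟨y', hy'm, hy'b, hyy'⟩ := exists_monotone_extension_Icc (hA.2 hB.1) hymono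
    fun a ha => ⟨hA.2 (hyX a ha), hB.2 (hyX a ha)⟩
  obtain ⟨W, hWmono, hWb, hVW⟩ := exists_monotone_extension_Icc
    (sub_nonneg.2 (humono B hB.1 _ ha₀.1 _ ha₁.1 (ha₀.2 ha₁.1))) hVmono
    fun a ha => ⟨hV.1 a ha, hVB a ha⟩
  refine ⟨y', W, ⟨hy'm, hWmono, hy'b, hWb, fun a ha => hyy' ha ▸ hyX a ha,
    fun a ha a' ha' => ?_⟩, fun a ha => ?_⟩
  · rw [← hyy' ha', ← hVW ha', ← hVW ha]
    exact hVic a ha a' ha'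
  · rw [← hyy' ha, ← hVW ha]
    linarith [hymax a ha _ (hxX a ha) (hxm a ha), minRent_le hWy ha, minRent_le hU ha]

/-- Uniformly bounded monotone fully incentive compatible mechanisms are sequentially compact
for pointwise convergence. -/
theorem MonotoneIC.exists_subseq {A B M : ℝ} (hX : IsClosed X)
    (huc : Continuous fun p : ℝ × ℝ => u p.1 p.2) {x W : ℕ → ℝ → ℝ}
    (h : ∀ n, MonotoneIC Θ X u A B M (x n) (W n)) :
    ∃ (y V : ℝ → ℝ) (φ : ℕ → ℕ), StrictMono φ ∧ MonotoneIC Θ X u A B M y V ∧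
      (∀ a, Tendsto (fun n => x (φ n) a) atTop (𝓝 (y a))) ∧
      ∀ a, Tendsto (fun n => W (φ n) a) atTop (𝓝 (V a)) := by
  obtain ⟨y, φ, hφ, hy, hyb, hxy⟩ := exists_subseq_tendsto_of_monotone x
    (fun n => (h n).monotone_alloc) fun n => (h n).alloc_mem_Icc
  obtain ⟨V, ψ, hψ, hV, hVb, hWV⟩ := exists_subseq_tendsto_of_monotone (fun n => W (φ n))
    (fun n => (h _).monotone_rent) fun n => (h _).rent_mem_Icc
  have hxy' : ∀ a, Tendsto (fun n => x (φ (ψ n)) a) atTop (𝓝 (y a)) := fun a =>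
    (hxy a).comp hψ.tendsto_atTop
  have hu : ∀ a b, Tendsto (fun n => u (x (φ (ψ n)) a) b) atTop (𝓝 (u (y a) b)) := fun a b =>
    (huc.tendsto (y a, b)).comp ((hxy' a).prodMk_nhds tendsto_const_nhds)
  exact ⟨y, V, φ ∘ ψ, hφ.comp hψ, ⟨hy, hV, hyb, hVb,
    fun a ha => hX.mem_of_tendsto (hxy' a) (Eventually.of_forall fun n => (h _).alloc_mem a ha),
    fun a ha a' ha' => le_of_tendsto_of_tendsto'
      ((hWV a').add ((hu a' a).sub (hu a' a'))) (hWV a) fun n => (h _).ic a ha a' ha'⟩,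
    hxy', hWV⟩

end Rents

theorem ContinuousOn.exists_continuous_curried {S : Set (ℝ × ℝ)} (hS : IsClosed S)
    {f : ℝ → ℝ → ℝ} (hf : ContinuousOn (fun p : ℝ × ℝ => f p.1 p.2) S) :
    ∃ g : ℝ → ℝ → ℝ, Continuous (fun p : ℝ × ℝ => g p.1 p.2) ∧
      ∀ y a, (y, a) ∈ S → g y a = f y a := by
  obtain ⟨g, hg⟩ := ContinuousMap.exists_restrict_eq hS ⟨_, hf.domRestrict⟩
  exact ⟨fun y a => g (y, a), g.continuous, fun y a h => DFunLike.congr_fun hg ⟨(y, a), h⟩⟩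

/-- Downward sufficiency for payoff functions that are continuous on the whole plane. -/
theorem exists_optimal_of_continuous
    (Θ X : Set ℝ) (hΘ : IsCompact Θ) (hX : IsCompact X) (hXne : X.Nonempty)
    (μ : Measure ℝ) [IsProbabilityMeasure μ] (hμ : ∀ᵐ a ∂μ, a ∈ Θ)
    (u v : ℝ → ℝ → ℝ)
    (huc : Continuous fun p : ℝ × ℝ => u p.1 p.2)
    (hvc : Continuous fun p : ℝ × ℝ => v p.1 p.2)
    (humono : ∀ x ∈ X, ∀ a ∈ Θ, ∀ a' ∈ Θ, a ≤ a' → u x a ≤ u x a')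
    (hID : IncDiff Θ X u)
    (hs : ∀ y ∈ X, ∀ z ∈ X, y < z → ∀ a ∈ Θ, ∀ a' ∈ Θ, a < a' →
      0 < (u z a + v z a) - (u y a + v y a) → 0 < (u z a' + v z a') - (u y a' + v y a')) :
    ∃ x t : ℝ → ℝ, DICMech Θ X u μ x t ∧
      (∀ x' t' : ℝ → ℝ, DICMech Θ X u μ x' t' → PPayoff v μ x' t' ≤ PPayoff v μ x t) ∧
      (∀ a ∈ Θ, ∀ a' ∈ Θ, u (x a) a - t a ≥ u (x a') a - t a') := by
  have hΘne : Θ.Nonempty := hμ.exists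
  obtain ⟨a₀, ha₀⟩ := hΘ.exists_isLeast hΘne
  obtain ⟨a₁, ha₁⟩ := hΘ.exists_isGreatest hΘne
  obtain ⟨A, hA⟩ := hX.exists_isLeast hXne
  obtain ⟨B, hB⟩ := hX.exists_isGreatest hXne
  set s : ℝ → ℝ → ℝ := fun y a => u y a + v y a
  have hsc : Continuous fun p : ℝ × ℝ => s p.1 p.2 := huc.add hvc
  set M := u B a₁ - u B a₀
  have himp := fun x U => exists_monotoneIC_ge (x := x) (U := U) hX (s := s) ha₀ ha₁ hA hB huc
    hsc humono hID hs
  obtain ⟨C, hC⟩ := (hX.prod hΘ).exists_bound_of_continuousOn hsc.continuousOn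
  obtain ⟨C', hC'⟩ := (hX.prod hΘ).exists_bound_of_continuousOn huc.continuousOn
  obtain ⟨C'', hC''⟩ := (hX.prod hΘ).exists_bound_of_continuousOn hvc.continuousOn
  have hmeas : ∀ {f : ℝ → ℝ → ℝ} {x : ℝ → ℝ}, Continuous (fun p : ℝ × ℝ => f p.1 p.2) →
      Measurable x → Measurable fun a => f (x a) a := fun hf hx =>
    hf.measurable.comp (hx.prodMk measurable_id)
  have hbound : ∀ {x W : ℝ → ℝ}, MonotoneIC Θ X u A B M x W → ∀ a ∈ Θ,
      ‖s (x a) a - W a‖ ≤ C + M := fun {x W} h a ha => by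
    refine (norm_sub_le _ _).trans (add_le_add (hC (x a, a) ⟨h.alloc_mem a ha, ha⟩) ?_)
    rw [Real.norm_of_nonneg (h.rent_mem_Icc a).1]
    exact (h.rent_mem_Icc a).2
  have hmeasJ : ∀ {x W : ℝ → ℝ}, MonotoneIC Θ X u A B M x W →
      Measurable fun a => s (x a) a - W a := fun h =>
    (hmeas hsc h.monotone_alloc.measurable).sub h.monotone_rent.measurable
  have hint : ∀ {x W : ℝ → ℝ}, MonotoneIC Θ X u A B M x W →
      Integrable (fun a => s (x a) a - W a) μ := fun h =>
    Integrable.of_bound (hmeasJ h).aestronglyMeasurable (C + M)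
      (hμ.mono fun a ha => hbound h a ha)
  set J : Set ℝ := {r | ∃ x W, MonotoneIC Θ X u A B M x W ∧ ∫ a, (s (x a) a - W a) ∂μ = r}
  have hJne : J.Nonempty := by
    obtain ⟨y, W, h, -⟩ := himp (fun _ => B) (fun a => u B a - u B a₀) (fun _ _ => hB.1)
      ⟨fun a ha => sub_nonneg.2 (humono B hB.1 _ ha₀.1 _ ha (ha₀.2 ha)),
        fun a _ k _ _ => by dsimp only; linarith⟩
    exact ⟨_, y, W, h, rfl⟩
  have hJb : BddAbove J := by
    refine ⟨C + M, ?_⟩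
    rintro _ ⟨x, W, h, rfl⟩
    calc ∫ a, (s (x a) a - W a) ∂μ ≤ ∫ _, (C + M) ∂μ :=
          integral_mono_ae (hint h) (integrable_const _)
            (hμ.mono fun a ha => (le_abs_self _).trans (hbound h a ha))
      _ = C + M := by simp
  obtain ⟨r, -, hr, hrJ⟩ := exists_seq_tendsto_sSup hJne hJb
  choose x W hxW hxWr using hrJ
  obtain ⟨y, V, φ, hφ, hyV, hxy, hWV⟩ := MonotoneIC.exists_subseq hX.isClosed huc hxW
  have hlim : Tendsto (fun n => ∫ a, (s (x (φ n) a) a - W (φ n) a) ∂μ) atTop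
      (𝓝 (∫ a, (s (y a) a - V a) ∂μ)) :=
    tendsto_integral_of_dominated_convergence (fun _ => C + M)
      (fun n => (hmeasJ (hxW _)).aestronglyMeasurable) (integrable_const _)
      (fun n => hμ.mono fun a ha => hbound (hxW _) a ha)
      (Eventually.of_forall fun a => ((hsc.tendsto (y a, a)).comp
        ((hxy a).prodMk_nhds tendsto_const_nhds)).sub (hWV a))
  simp only [hxWr] at hlim
  have hopt : ∫ a, (s (y a) a - V a) ∂μ = sSup J :=
    tendsto_nhds_unique hlim (hr.comp hφ.tendsto_atTop)
  have hpay : ∀ x t : ℝ → ℝ,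
      PPayoff v μ x t = ∫ a, (s (x a) a - (u (x a) a - t a)) ∂μ := fun x t => by
    unfold PPayoff
    congr 1 with a
    simp only [s]
    ring
  refine ⟨y, fun a => u (y a) a - V a, ⟨hyV.monotone_alloc.measurable,
    (hmeas huc hyV.monotone_alloc.measurable).sub hyV.monotone_rent.measurable, ?_,
    hyV.alloc_mem, fun a ha a' ha' _ => ?_, fun a ha => ?_⟩, fun x' t' h' => ?_,
    fun a ha a' ha' => ?_⟩
  · refine Integrable.of_bound ((hmeas huc hyV.monotone_alloc.measurable).sub
      hyV.monotone_rent.measurable).aestronglyMeasurable (C' + M) (hμ.mono fun a ha => ?_)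
    refine (norm_sub_le _ _).trans (add_le_add (hC' (y a, a) ⟨hyV.alloc_mem a ha, ha⟩) ?_)
    rw [Real.norm_of_nonneg (hyV.rent_mem_Icc a).1]
    exact (hyV.rent_mem_Icc a).2
  · linarith [hyV.ic a ha a' ha']
  · linarith [(hyV.rent_mem_Icc a).1]
  · obtain ⟨hx'm, ht'm, ht'i, hx'X, hdic, hir⟩ := h'
    obtain ⟨z, Z, hz, hle⟩ := himp x' (fun a => u (x' a) a - t' a) hx'X
      ⟨fun a ha => hir a ha, fun a ha a' ha' h => by linarith [hdic a ha a' ha' h]⟩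
    have hint' : Integrable (fun a => s (x' a) a - (u (x' a) a - t' a)) μ := by
      have hv' : Integrable (fun a => v (x' a) a) μ :=
        Integrable.of_bound (hmeas hvc hx'm).aestronglyMeasurable C''
          (hμ.mono fun a ha => hC'' (x' a, a) ⟨hx'X a ha, ha⟩)
      refine (hv'.add ht'i).congr (Eventually.of_forall fun a => ?_)
      simp only [s, Pi.add_apply]
      ring
    calc PPayoff v μ x' t' = ∫ a, (s (x' a) a - (u (x' a) a - t' a)) ∂μ := hpay _ _
      _ ≤ ∫ a, (s (z a) a - Z a) ∂μ := integral_mono_ae hint' (hint hz) (hμ.mono hle)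
      _ ≤ sSup J := le_csSup hJb ⟨z, Z, hz, rfl⟩
      _ = ∫ a, (s (y a) a - V a) ∂μ := hopt.symm
      _ = PPayoff v μ y fun a => u (y a) a - V a := by simp only [hpay, sub_sub_cancel]
  · linarith [hyV.ic a ha a' ha']

theorem DICMech.congr {Θ X : Set ℝ} {u u' : ℝ → ℝ → ℝ} {μ : Measure ℝ} {x t : ℝ → ℝ}
    (huu : ∀ y ∈ X, ∀ a ∈ Θ, u y a = u' y a) (h : DICMech Θ X u μ x t) :
    DICMech Θ X u' μ x t := by
  obtain ⟨hx, ht, hti, hxX, hdic, hir⟩ := h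
  refine ⟨hx, ht, hti, hxX, fun a ha a' ha' haa => ?_, fun a ha => ?_⟩
  · rw [← huu _ (hxX a ha) a ha, ← huu _ (hxX a' ha') a ha]
    exact hdic a ha a' ha' haa
  · rw [← huu _ (hxX a ha) a ha]
    exact hir a ha

/-- **Downward sufficiency (Proposition 2).** In a standard one-dimensional
screening problem whose surplus function `u + v` has weak single-crossing
differences, some mechanism attains the supremum of the principal's payoff over all
measurable mechanisms satisfying the downward IC and IR constraints, and that
mechanism satisfies all IC constraints. -/
theorem stmt3
    (Θ X : Set ℝ) (hΘ : IsCompact Θ) (hX : IsCompact X) (hXne : X.Nonempty)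
    (μ : Measure ℝ) (hμp : IsProbabilityMeasure μ) (hμsupp : μ Θᶜ = 0)
    (u v : ℝ → ℝ → ℝ)
    (huc : ContinuousOn (fun p : ℝ × ℝ => u p.1 p.2) (X ×ˢ Θ))
    (hvc : ContinuousOn (fun p : ℝ × ℝ => v p.1 p.2) (X ×ˢ Θ))
    (humono : ∀ x ∈ X, ∀ a ∈ Θ, ∀ a' ∈ Θ, a ≤ a' → u x a ≤ u x a')
    (hSID : ∀ x ∈ X, ∀ x' ∈ X, x < x' → ∀ a ∈ Θ, ∀ a' ∈ Θ, a < a' →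
      u x' a - u x a < u x' a' - u x a')
    (hWSCD : ∀ x ∈ X, ∀ x' ∈ X, x < x' → ∀ a ∈ Θ, ∀ a' ∈ Θ, a < a' →
      0 < (u x' a + v x' a) - (u x a + v x a) →
      0 < (u x' a' + v x' a') - (u x a' + v x a')) :
    ∃ x t : ℝ → ℝ, DICMech Θ X u μ x t ∧
      (∀ x' t' : ℝ → ℝ, DICMech Θ X u μ x' t' →
        PPayoff v μ x' t' ≤ PPayoff v μ x t) ∧
      (∀ a ∈ Θ, ∀ a' ∈ Θ, u (x a) a - t a ≥ u (x a') a - t a') := by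
  have hμ : ∀ᵐ a ∂μ, a ∈ Θ := hμsupp
  have hS : IsClosed (X ×ˢ Θ) := hX.isClosed.prod hΘ.isClosed
  obtain ⟨u', hu'c, hu'⟩ := ContinuousOn.exists_continuous_curried hS huc
  obtain ⟨v', hv'c, hv'⟩ := ContinuousOn.exists_continuous_curried hS hvc
  have hu : ∀ y ∈ X, ∀ a ∈ Θ, u' y a = u y a := fun y hy a ha => hu' y a ⟨hy, ha⟩
  have hv : ∀ y ∈ X, ∀ a ∈ Θ, v' y a = v y a := fun y hy a ha => hv' y a ⟨hy, ha⟩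
  have hpay : ∀ x t : ℝ → ℝ, (∀ a ∈ Θ, x a ∈ X) → PPayoff v' μ x t = PPayoff v μ x t :=
    fun x t hx => integral_congr_ae (hμ.mono fun a ha => by simp only [hv _ (hx a ha) a ha])
  obtain ⟨x, t, h, hopt, hic⟩ := exists_optimal_of_continuous Θ X hΘ hX hXne μ hμ u' v' hu'c hv'c
    (fun y hy a ha a' ha' haa => by
      rw [hu y hy a ha, hu y hy a' ha']
      exact humono y hy a ha a' ha' haa)
    (fun y hy z hz hyz a ha b hb hab => by
      rw [hu y hy a ha, hu y hy b hb, hu z hz a ha, hu z hz b hb]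
      rcases hyz.eq_or_lt with rfl | hyz
      · exact le_rfl
      rcases hab.eq_or_lt with rfl | hab
      · simp
      linarith [hSID y hy z hz hyz a ha b hb hab])
    (fun y hy z hz hyz a ha b hb hab => by
      rw [hu y hy a ha, hu y hy b hb, hu z hz a ha, hu z hz b hb,
        hv y hy a ha, hv y hy b hb, hv z hz a ha, hv z hz b hb]
      exact hWSCD y hy z hz hyz a ha b hb hab)
  have hxX : ∀ a ∈ Θ, x a ∈ X := h.2.2.2.1
  refine ⟨x, t, h.congr hu, fun x' t' h' => ?_, fun a ha a' ha' => ?_⟩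
  · rw [← hpay x t hxX, ← hpay x' t' h'.2.2.2.1]
    exact hopt x' t' (h'.congr fun y hy a ha => (hu y hy a ha).symm)
  · rw [← hu _ (hxX a ha) a ha, ← hu _ (hxX a' ha') a ha]
    exact hic a ha a' ha'
end
end
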